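/- arXiv:1511.00583 — 7 statements merged into one kernel-verified Lean document; each statement's English description precedes it below -/
import Mathlib

section
/- Fix t ≥ 55 and m ≥ n ≥ t, and let (X, Σ) be a random t-sparse set system with |X| = n, |Σ| = m. Let I = {i : |S_i| ≥ 6t} be the set of indices of large sets, and let E be the event that there exists a choice of elements x_i ∈ S_i for each i ∈ I such that the sets {S_i \ {x_i} : i ∈ I} are pairwise disjoint. Then Pr[E] ≥ 1 − 2^{−t}. -/
open Finset

open scoped Classical

/-- The discrepancy of a set system `S : Fin m → Finset (Fin n)`. -/
noncomputable def disc {n m : ℕ} (S : Fin m → Finset (Fin n)) : ℕ :=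
  sInf {d : ℕ | ∃ χ : Fin n → ℤ, (∀ x, χ x = 1 ∨ χ x = -1) ∧
    ∀ i : Fin m, (∑ x ∈ S i, χ x).natAbs ≤ d}

/-- The hereditary discrepancy: the maximum of `disc` over restrictions to `Y ⊆ X`. -/
noncomputable def herdisc {n m : ℕ} (S : Fin m → Finset (Fin n)) : ℕ :=
  Finset.univ.sup fun Y : Finset (Fin n) => disc fun i => S i ∩ Y

/-- The sample space of a random `t`-sparse set system: each element `x ∈ X`
independently gets a uniformly random `t`-element subset `T x ⊆ [m]` of set indices.
The uniform distribution on this finite set is the distribution of the random system. -/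
noncomputable def sparseChoices (n m t : ℕ) : Finset (Fin n → Finset (Fin m)) :=
  Finset.univ.filter fun T => ∀ x, (T x).card = t

/-- The set system determined by membership choices `T`: `S_i = {x : i ∈ T x}`. -/
noncomputable def setsOf {n m : ℕ} (T : Fin n → Finset (Fin m)) : Fin m → Finset (Fin n) :=
  fun i => Finset.univ.filter fun x => i ∈ T x

/-- If `s` has more than `j` edges in excess of its right endpoints, it contains `j + 1` edges whose
right endpoints are covered by disjointly chosen further edges of any larger edge set `E`. -/
lemma exists_disjoint_covering_edges {α β : Type*} [DecidableEq α] [DecidableEq β]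
    (E s : Finset (α × β)) (hsE : s ⊆ E)
    (j g : ℕ) (hs : j + #(s.image Prod.snd) < #s) (hjg : j + 1 ≤ g) (hE : g + (j + 1) ≤ #E) :
    ∃ G R : Finset (α × β), G ⊆ E ∧ R ⊆ E ∧ Disjoint G R ∧ #G = g ∧ #R = j + 1 ∧
      R.image Prod.snd ⊆ G.image Prod.snd := by
  have hne : s.Nonempty := by
    rw [← Finset.card_pos]; omega
  have hr : ∀ x : β, ∃ e ∈ s, x ∈ s.image Prod.snd → e.2 = x := by
    intro x
    by_cases hx : x ∈ s.image Prod.snd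
    · obtain ⟨e, he, rfl⟩ := Finset.mem_image.1 hx
      exact ⟨e, he, fun _ => rfl⟩
    · obtain ⟨e, he⟩ := hne
      exact ⟨e, he, fun h => absurd h hx⟩
  choose r hrs hr using hr
  have hcard : j + 1 ≤ #(s \ (s.image Prod.snd).image r) := by
    have h1 := Finset.le_card_sdiff ((s.image Prod.snd).image r) s
    have h2 : #((s.image Prod.snd).image r) ≤ #(s.image Prod.snd) := Finset.card_image_le
    omega
  obtain ⟨R, hRs, hRc⟩ := Finset.exists_subset_card_eq hcard
  have hR : ∀ e ∈ R, e ∈ s ∧ e ∉ (s.image Prod.snd).image r := fun e he =>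
    Finset.mem_sdiff.1 (hRs he)
  have hRE : R ⊆ E := fun e he => hsE (hR e he).1
  have hsub : (R.image Prod.snd).image r ⊆ E \ R := by
    intro e he
    obtain ⟨x, hx, rfl⟩ := Finset.mem_image.1 he
    obtain ⟨e', he', rfl⟩ := Finset.mem_image.1 hx
    refine Finset.mem_sdiff.2 ⟨hsE (hrs _), fun hmem => (hR _ hmem).2 ?_⟩
    exact Finset.mem_image_of_mem _ (Finset.mem_image_of_mem _ (hR _ he').1)
  have hle : #((R.image Prod.snd).image r) ≤ g :=
    (Finset.card_image_le.trans Finset.card_image_le).trans (hRc.trans_le hjg)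
  have hge : g ≤ #(E \ R) := by
    rw [Finset.card_sdiff_of_subset hRE]; omega
  obtain ⟨G, hG1, hG2, hGc⟩ := Finset.exists_subsuperset_card_eq hsub hle hge
  refine ⟨G, R, fun e he => (Finset.mem_sdiff.1 (hG2 he)).1, hRE,
    Finset.disjoint_left.2 fun e he => (Finset.mem_sdiff.1 (hG2 he)).2, hGc, hRc, ?_⟩
  intro x hx
  have hxs : x ∈ s.image Prod.snd := by
    obtain ⟨e, he, rfl⟩ := Finset.mem_image.1 hx
    exact Finset.mem_image_of_mem _ (hR _ he).1
  exact Finset.mem_image.2 ⟨r x, hG1 (Finset.mem_image_of_mem _ hx), hr x hxs⟩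

/-- One element can be deleted from each member of a family of nonempty sets so that the remaining
sets are disjoint, provided no set of incidences outnumbers the vertices it touches. -/
lemma exists_disjoint_erase {α β : Type*} [DecidableEq α] [DecidableEq β] [Nonempty β]
    (S : α → Finset β) (P : α → Prop)
    (hne : ∀ i, P i → (S i).Nonempty)
    (hall : ∀ s : Finset (α × β), (∀ e ∈ s, P e.1 ∧ e.2 ∈ S e.1) →
      #s ≤ #(s.image Prod.fst) + #(s.image Prod.snd)) :
    ∃ f : α → β, (∀ i, P i → f i ∈ S i) ∧
      ∀ i j, i ≠ j → P i → P j → Disjoint ((S i).erase (f i)) ((S j).erase (f j)) := by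
  let ι := {e : α × β // P e.1 ∧ e.2 ∈ S e.1}
  let v : ι → Finset (α ⊕ β) := fun e => {Sum.inl e.1.1, Sum.inr e.1.2}
  obtain ⟨φ, hφ, hφv⟩ := (Finset.all_card_le_biUnion_card_iff_exists_injective v).1 (by
    intro s
    have h := hall (s.map (Function.Embedding.subtype _)) (by
      intro e he
      obtain ⟨e', -, rfl⟩ := Finset.mem_map.1 he
      exact e'.2)
    rw [Finset.card_map, ← Finset.card_disjSum] at h
    refine h.trans (Finset.card_le_card ?_)
    intro z hz
    rcases Finset.mem_disjSum.1 hz with ⟨a, ha, rfl⟩ | ⟨b, hb, rfl⟩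
    · obtain ⟨e, he, rfl⟩ := Finset.mem_image.1 ha
      obtain ⟨e', he', rfl⟩ := Finset.mem_map.1 he
      exact Finset.mem_biUnion.2 ⟨e', he', by simp [v]⟩
    · obtain ⟨e, he, rfl⟩ := Finset.mem_image.1 hb
      obtain ⟨e', he', rfl⟩ := Finset.mem_map.1 he
      exact Finset.mem_biUnion.2 ⟨e', he', by simp [v]⟩)
  have hf : ∀ i, ∃ b : β, P i → b ∈ S i ∧ ∀ e : ι, e.1.1 = i → φ e = Sum.inl i → e.1.2 = b := by
    intro i
    by_cases hi : P i
    · by_cases h : ∃ e : ι, e.1.1 = i ∧ φ e = Sum.inl i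
      · obtain ⟨e, he, hφe⟩ := h
        refine ⟨e.1.2, fun _ => ⟨he ▸ e.2.2, fun e' _ h' => ?_⟩⟩
        rw [hφ (h'.trans hφe.symm)]
      · obtain ⟨b, hb⟩ := hne i hi
        exact ⟨b, fun _ => ⟨hb, fun e he he' => absurd ⟨e, he, he'⟩ h⟩⟩
    · exact ⟨Classical.arbitrary β, fun h => absurd h hi⟩
  choose f hf using hf
  refine ⟨f, fun i hi => (hf i hi).1, fun i j hij hi hj => Finset.disjoint_left.2 ?_⟩
  have key : ∀ i (hi : P i) x (hx : x ∈ S i), x ≠ f i → φ ⟨(i, x), hi, hx⟩ = Sum.inr x := by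
    intro i hi x hx hxf
    have hm := hφv ⟨(i, x), hi, hx⟩
    simp only [v, Finset.mem_insert, Finset.mem_singleton] at hm
    rcases hm with hm | hm
    · exact absurd ((hf i hi).2 _ rfl hm) hxf
    · exact hm
  intro x hxi hxj
  rw [Finset.mem_erase] at hxi hxj
  have h := hφ ((key i hi x hxi.2 hxi.1).trans (key j hj x hxj.2 hxj.1).symm)
  exact hij (congrArg (fun e : ι => e.1.1) h)

lemma pow_mul_choose_sub_le {m t : ℕ} (htm : t ≤ m) (k : ℕ) (hk : k ≤ t) :
    m ^ k * (m - k).choose (t - k) ≤ t ^ k * m.choose t := by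
  induction k with
  | zero => simp
  | succ k ih =>
    have ih := ih (by omega)
    obtain ⟨b, rfl⟩ : ∃ b, t = b + 1 + k := ⟨t - k - 1, by omega⟩
    obtain ⟨a, rfl⟩ : ∃ a, m = a + 1 + k := ⟨m - k - 1, by omega⟩
    have e1 : a + 1 + k - k = a + 1 := by omega
    have e2 : b + 1 + k - k = b + 1 := by omega
    have e3 : a + 1 + k - (k + 1) = a := by omega
    have e4 : b + 1 + k - (k + 1) = b := by omega
    rw [e1, e2] at ih
    rw [e3, e4]
    have hab : b ≤ a := by omega
    have hc := Nat.add_one_mul_choose_eq a b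
    have hfrac : (a + 1 + k) * (b + 1) ≤ (b + 1 + k) * (a + 1) := by nlinarith
    refine le_of_mul_le_mul_left (a := a + 1) ?_ (Nat.succ_pos a)
    calc (a + 1) * ((a + 1 + k) ^ (k + 1) * a.choose b)
        = (a + 1 + k) ^ (k + 1) * ((a + 1) * a.choose b) := by ring
      _ = ((a + 1 + k) * (b + 1)) * ((a + 1 + k) ^ k * (a + 1).choose (b + 1)) := by
          rw [hc]; ring
      _ ≤ ((b + 1 + k) * (a + 1)) * ((b + 1 + k) ^ k * (a + 1 + k).choose (b + 1 + k)) :=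
          Nat.mul_le_mul hfrac ih
      _ = _ := by ring

lemma pow_mul_card_powersetCard_superset_le {α : Type*} [Fintype α] [DecidableEq α] {t : ℕ}
    (ht : t ≤ Fintype.card α) (K : Finset α) :
    Fintype.card α ^ #K * #{A ∈ powersetCard t (univ : Finset α) | K ⊆ A} ≤
      t ^ #K * #(powersetCard t (univ : Finset α)) := by
  by_cases hK : #K ≤ t
  · have h1 : #{A ∈ powersetCard t (univ : Finset α) | K ⊆ A} ≤
        (Fintype.card α - #K).choose (t - #K) := by
      rw [← Finset.card_compl, ← Finset.card_powersetCard]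
      refine Finset.card_le_card_of_injOn (fun A => A \ K) ?_ ?_
      · intro A hA
        simp only [Finset.coe_filter, Set.mem_ofPred_eq, Finset.mem_powersetCard] at hA
        simp only [Finset.mem_coe, Finset.mem_powersetCard]
        refine ⟨fun x hx => by simpa using (Finset.mem_sdiff.1 hx).2, ?_⟩
        rw [Finset.card_sdiff_of_subset hA.2, hA.1.2]
      · intro A hA B hB hAB
        simp only [Finset.coe_filter, Set.mem_ofPred_eq] at hA hB
        rw [← Finset.sdiff_union_of_subset hA.2, ← Finset.sdiff_union_of_subset hB.2]
        exact congrArg (· ∪ K) hAB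
    rw [Finset.card_powersetCard, Finset.card_univ]
    exact (Nat.mul_le_mul_left _ h1).trans (pow_mul_choose_sub_le ht _ hK)
  · rw [Finset.filter_false_of_mem]
    · simp
    · intro A hA hKA
      have := Finset.card_le_card hKA
      rw [(Finset.mem_powersetCard.1 hA).2] at this
      exact hK this

lemma sparseChoices_eq_piFinset (n m t : ℕ) :
    sparseChoices n m t =
      Fintype.piFinset fun _ : Fin n => powersetCard t (univ : Finset (Fin m)) := by
  ext T
  simp [sparseChoices]

/-- A fixed set `H` of incidences is present with probability at most `(t / m) ^ #H`. -/
lemma pow_mul_card_sparseChoices_le {n m t : ℕ} (ht : t ≤ m) (H : Finset (Fin m × Fin n)) :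
    m ^ #H * #{T ∈ sparseChoices n m t | ∀ e ∈ H, e.1 ∈ T e.2} ≤
      t ^ #H * #(sparseChoices n m t) := by
  let K : Fin n → Finset (Fin m) := fun x => univ.filter fun i => (i, x) ∈ H
  have hfilter : {T ∈ sparseChoices n m t | ∀ e ∈ H, e.1 ∈ T e.2} =
      Fintype.piFinset fun x => {A ∈ powersetCard t (univ : Finset (Fin m)) | K x ⊆ A} := by
    ext T
    simp only [sparseChoices_eq_piFinset, Finset.mem_filter, Fintype.mem_piFinset]
    constructor
    · rintro ⟨h1, h2⟩ x
      exact ⟨h1 x, fun i hi => h2 (i, x) (by simpa [K] using hi)⟩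
    · intro h
      exact ⟨fun x => (h x).1, fun e he => (h e.2).2 (by simpa [K] using he)⟩
  have hH : #H = ∑ x, #(K x) := by
    rw [Finset.card_eq_sum_card_fiberwise (f := Prod.snd) (t := univ) (by simp)]
    refine Finset.sum_congr rfl fun x _ => ?_
    refine Finset.card_bij' (fun e _ => e.1) (fun i _ => (i, x)) ?_ ?_ ?_ ?_
    · rintro ⟨i, y⟩ he
      obtain ⟨he, rfl⟩ := Finset.mem_filter.1 he
      simpa [K] using he
    · intro i hi
      simpa [K] using hi
    · rintro ⟨i, y⟩ he
      obtain ⟨he, rfl⟩ := Finset.mem_filter.1 he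
      rfl
    · intro i hi
      rfl
  rw [hfilter, sparseChoices_eq_piFinset, Fintype.card_piFinset, Fintype.card_piFinset, hH,
    ← Finset.prod_pow_eq_pow_sum, ← Finset.prod_pow_eq_pow_sum, ← Finset.prod_mul_distrib,
    ← Finset.prod_mul_distrib]
  refine Finset.prod_le_prod' fun x _ => ?_
  simpa using pow_mul_card_powersetCard_superset_le (α := Fin m) (by simpa using ht) (K x)

/-- The choices `T` for which all incidences in the disjoint sets `G` and `R` are present. -/
noncomputable def containing (n m t : ℕ) (G R : Finset (Fin m × Fin n)) :
    Finset (Fin n → Finset (Fin m)) :=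
  {T ∈ sparseChoices n m t | Disjoint G R ∧ ∀ e ∈ G ∪ R, e.1 ∈ T e.2}

lemma card_containing_le {n m t : ℕ} (hm : 0 < m) (ht : t ≤ m) (G R : Finset (Fin m × Fin n)) :
    (#(containing n m t G R) : ℝ) ≤ ((t : ℝ) / m) ^ (#G + #R) * #(sparseChoices n m t) := by
  by_cases hGR : Disjoint G R
  · have h := pow_mul_card_sparseChoices_le ht (G ∪ R)
    rw [Finset.card_union_of_disjoint hGR] at h
    have h' : (m : ℝ) ^ (#G + #R) * #(containing n m t G R) ≤
        (t : ℝ) ^ (#G + #R) * #(sparseChoices n m t) := by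
      simp only [containing, hGR, true_and]
      exact_mod_cast h
    have hm' : (0 : ℝ) < (m : ℝ) ^ (#G + #R) := by positivity
    rw [div_pow, div_mul_eq_mul_div, le_div_iff₀ hm']
    linarith
  · have : containing n m t G R = ∅ := by
      simp [containing, hGR]
    rw [this]
    simp only [Finset.card_empty, Nat.cast_zero]
    positivity

/-- The choices for which some `j` sets carry `6 * t * j` incidences, of which `j + 1` meet elements
already covered by the others. -/
noncomputable def crowded (n m t j : ℕ) : Finset (Fin n → Finset (Fin m)) :=
  (powersetCard j (univ : Finset (Fin m))).biUnion fun J =>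
    (powersetCard (6 * t * j - (j + 1)) (J ×ˢ (univ : Finset (Fin n)))).biUnion fun G =>
      (powersetCard (j + 1) (J ×ˢ G.image Prod.snd)).biUnion fun R => containing n m t G R

lemma card_crowded_le {n m t j : ℕ} (hm : 0 < m) (ht : t ≤ m) (hj : j + 1 ≤ 6 * t * j) :
    (#(crowded n m t j) : ℝ) ≤
      (m.choose j : ℝ) * ((j * n).choose (6 * t * j - (j + 1)) : ℝ) *
        ((j * (6 * t * j)).choose (j + 1) : ℝ) * ((t : ℝ) / m) ^ (6 * t * j) *
          #(sparseChoices n m t) := by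
  set g := 6 * t * j - (j + 1) with hg
  have hgj : g + (j + 1) = 6 * t * j := by omega
  set c : ℝ := ((t : ℝ) / m) ^ (6 * t * j) * #(sparseChoices n m t) with hc
  have hc0 : 0 ≤ c := by positivity
  have hR : ∀ J ∈ powersetCard j (univ : Finset (Fin m)),
      ∀ G ∈ powersetCard g (J ×ˢ (univ : Finset (Fin n))),
      (#((powersetCard (j + 1) (J ×ˢ G.image Prod.snd)).biUnion
        fun R => containing n m t G R) : ℝ) ≤ ((j * (6 * t * j)).choose (j + 1) : ℝ) * c := by
    intro J hJ G hG
    have hJc := (Finset.mem_powersetCard.1 hJ).2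
    have hGc := (Finset.mem_powersetCard.1 hG).2
    calc _ ≤ ((∑ R ∈ powersetCard (j + 1) (J ×ˢ G.image Prod.snd),
          #(containing n m t G R) : ℕ) : ℝ) := by exact_mod_cast Finset.card_biUnion_le
      _ ≤ ∑ R ∈ powersetCard (j + 1) (J ×ˢ G.image Prod.snd), c := by
          rw [Nat.cast_sum]
          refine Finset.sum_le_sum fun R hR => ?_
          have := card_containing_le (n := n) hm ht G R
          rwa [hGc, (Finset.mem_powersetCard.1 hR).2, hgj] at this
      _ ≤ _ := by
          rw [Finset.sum_const, nsmul_eq_mul, Finset.card_powersetCard, Finset.card_product, hJc]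
          refine mul_le_mul_of_nonneg_right ?_ hc0
          have : #(G.image Prod.snd) ≤ 6 * t * j := by
            have : #(G.image Prod.snd) ≤ #G := Finset.card_image_le
            omega
          exact_mod_cast Nat.choose_le_choose _ (Nat.mul_le_mul_left _ this)
  have hG : ∀ J ∈ powersetCard j (univ : Finset (Fin m)),
      (#((powersetCard g (J ×ˢ (univ : Finset (Fin n)))).biUnion fun G =>
        (powersetCard (j + 1) (J ×ˢ G.image Prod.snd)).biUnion
          fun R => containing n m t G R) : ℝ) ≤
        ((j * n).choose g : ℝ) * (((j * (6 * t * j)).choose (j + 1) : ℝ) * c) := by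
    intro J hJ
    have hJc := (Finset.mem_powersetCard.1 hJ).2
    refine (Nat.cast_le.2 Finset.card_biUnion_le).trans ?_
    rw [Nat.cast_sum]
    refine (Finset.sum_le_sum (hR J hJ)).trans ?_
    rw [Finset.sum_const, nsmul_eq_mul, Finset.card_powersetCard, Finset.card_product, hJc]
    simp
  refine (Nat.cast_le.2 Finset.card_biUnion_le).trans ?_
  rw [Nat.cast_sum]
  refine (Finset.sum_le_sum hG).trans ?_
  rw [Finset.sum_const, nsmul_eq_mul, Finset.card_powersetCard]
  simp only [Finset.card_univ, Fintype.card_fin]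
  rw [hc]
  exact le_of_eq (by ring)

lemma pow_div_factorial_le_three_pow (a k : ℕ) : (a : ℝ) ^ k / k.factorial ≤ 3 ^ a := by
  refine (Real.pow_div_factorial_le_exp (a : ℝ) (by positivity) k).trans ?_
  rw [← Real.exp_one_pow]
  exact pow_le_pow_left₀ (by positivity) Real.exp_one_lt_three.le _

lemma choose_product_le {n m t j : ℕ} (hm : 0 < m) (hnm : n ≤ m) (hjm : j ≤ m)
    (hj : j + 1 ≤ 6 * t * j) :
    (m.choose j : ℝ) * ((j * n).choose (6 * t * j - (j + 1)) : ℝ) *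
        ((j * (6 * t * j)).choose (j + 1) : ℝ) * ((t : ℝ) / m) ^ (6 * t * j) ≤
      (6 * t : ℝ) ^ (2 * j + 2) * 9 ^ j * (1 / 2) ^ (6 * t * j) := by
  obtain ⟨g, hg⟩ : ∃ g, g + (j + 1) = 6 * t * j := ⟨6 * t * j - (j + 1), by omega⟩
  have hg' : 6 * t * j - (j + 1) = g := by omega
  rw [hg']
  have hm0 : (0 : ℝ) < m := by exact_mod_cast hm
  have hnm' : (n : ℝ) ≤ m := by exact_mod_cast hnm
  have hjm' : (j : ℝ) ≤ m := by exact_mod_cast hjm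
  have hN : ((6 * t * j : ℕ) : ℝ) = 6 * t * j := by push_cast; ring
  have h1 : (m.choose j : ℝ) ≤ (m : ℝ) ^ j / j.factorial := Nat.choose_le_pow_div j m
  have h2 : ((j * n).choose g : ℝ) ≤ ((j : ℝ) * m) ^ g / g.factorial := by
    refine (Nat.choose_le_pow_div g (j * n)).trans ?_
    push_cast
    gcongr
  have h3 : ((j * (6 * t * j)).choose (j + 1) : ℝ) ≤
      ((j : ℝ) * (6 * t * j)) ^ (j + 1) / (j + 1).factorial := by
    refine (Nat.choose_le_pow_div (j + 1) (j * (6 * t * j))).trans ?_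
    push_cast
    exact le_rfl
  have f1 := pow_div_factorial_le_three_pow j j
  have f2 := pow_div_factorial_le_three_pow j (j + 1)
  have f3 := pow_div_factorial_le_three_pow (6 * t * j) g
  rw [hN] at f3
  calc _ ≤ ((m : ℝ) ^ j / j.factorial) * (((j : ℝ) * m) ^ g / g.factorial) *
        (((j : ℝ) * (6 * t * j)) ^ (j + 1) / (j + 1).factorial) * ((t : ℝ) / m) ^ (6 * t * j) := by
        gcongr
    _ = (j / m : ℝ) * (6 * t : ℝ) ^ (2 * j + 2) * ((j : ℝ) ^ j / j.factorial) *
        ((j : ℝ) ^ (j + 1) / (j + 1).factorial) *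
          ((6 * t * j : ℝ) ^ g / g.factorial) * (1 / 6) ^ (6 * t * j) := by
        rw [← hg]
        have e6 : (6 : ℝ) ^ (2 * j + 2) = 6 ^ (j + 1) * 6 ^ (j + 1) := by ring
        simp only [mul_pow, div_pow, e6, one_pow]
        field_simp
        ring
    _ ≤ 1 * (6 * t : ℝ) ^ (2 * j + 2) * 3 ^ j * 3 ^ j * 3 ^ (6 * t * j) * (1 / 6) ^ (6 * t * j) := by
        have : (j / m : ℝ) ≤ 1 := (div_le_one hm0).2 hjm'
        gcongr
    _ = (6 * t : ℝ) ^ (2 * j + 2) * 9 ^ j * (1 / 2) ^ (6 * t * j) := by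
        have a1 : (9 : ℝ) ^ j = 3 ^ j * 3 ^ j := by rw [← mul_pow]; norm_num
        have a2 : (1 / 2 : ℝ) ^ (6 * t * j) = 3 ^ (6 * t * j) * (1 / 6) ^ (6 * t * j) := by
          rw [← mul_pow]; norm_num
        rw [a1, a2]; ring

lemma incidence_weight_le {t j : ℕ} (ht : 15 ≤ t) (hj : 1 ≤ j) :
    (6 * t : ℝ) ^ (2 * j + 2) * 9 ^ j * (1 / 2) ^ (6 * t * j) ≤ (1 / 2) ^ t * (1 / 2) ^ j := by
  have ht1 : (1 : ℝ) ≤ 6 * t := by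
    have : (15 : ℝ) ≤ t := by exact_mod_cast ht
    linarith
  have htwo : (t : ℝ) ≤ 2 ^ t := by exact_mod_cast (Nat.lt_two_pow_self).le
  have hbase : (6 * t : ℝ) ^ 4 * 9 * (1 / 2) ^ (6 * t) ≤ (1 / 2) ^ (t + 1) := by
    have h4 : (t : ℝ) ^ 4 ≤ 2 ^ (4 * t) := by
      calc (t : ℝ) ^ 4 ≤ (2 ^ t) ^ 4 := by gcongr
        _ = 2 ^ (4 * t) := by rw [← pow_mul]; ring_nf
    have h5 : (11664 : ℝ) ≤ 2 ^ (t - 1) := by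
      calc (11664 : ℝ) ≤ 2 ^ 14 := by norm_num
        _ ≤ 2 ^ (t - 1) := pow_le_pow_right₀ (by norm_num) (by omega)
    have h6 : (6 * t : ℝ) ^ 4 * 9 ≤ 2 ^ (5 * t - 1) := by
      calc (6 * t : ℝ) ^ 4 * 9 = 11664 * (t : ℝ) ^ 4 := by ring
        _ ≤ 2 ^ (t - 1) * 2 ^ (4 * t) := by gcongr
        _ = 2 ^ (5 * t - 1) := by rw [← pow_add]; congr 1; omega
    have h7 : (1 / 2 : ℝ) ^ (6 * t) = (1 / 2) ^ (5 * t - 1) * (1 / 2) ^ (t + 1) := by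
      rw [← pow_add]; congr 1; omega
    calc _ ≤ 2 ^ (5 * t - 1) * ((1 / 2 : ℝ) ^ (5 * t - 1) * (1 / 2) ^ (t + 1)) := by
          rw [h7]; gcongr
      _ = (1 / 2) ^ (t + 1) := by
          rw [← mul_assoc, ← mul_pow]; norm_num
  calc _ ≤ (6 * t : ℝ) ^ (4 * j) * 9 ^ j * (1 / 2) ^ (6 * t * j) := by
        gcongr
        omega
    _ = ((6 * t : ℝ) ^ 4 * 9 * (1 / 2) ^ (6 * t)) ^ j := by
        rw [mul_pow _ _ j, mul_pow _ _ j, ← pow_mul, ← pow_mul]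
    _ ≤ ((1 / 2) ^ (t + 1)) ^ j := by gcongr
    _ = (1 / 2) ^ (t * j + j) := by rw [← pow_mul]; ring_nf
    _ ≤ (1 / 2) ^ (t + j) :=
        pow_le_pow_of_le_one (by norm_num) (by norm_num) (by nlinarith)
    _ = _ := pow_add _ _ _

lemma sum_half_pow_le_one (m : ℕ) : ∑ j ∈ Finset.Icc 1 m, (1 / 2 : ℝ) ^ j ≤ 1 := by
  have h : ∑ j ∈ Finset.Icc 1 m, (1 / 2 : ℝ) ^ j = 1 - (1 / 2) ^ m := by
    induction m with
    | zero => simp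
    | succ k ih =>
      rw [Finset.sum_Icc_succ_top (by omega), ih]
      ring
  rw [h]
  have : (0 : ℝ) ≤ (1 / 2) ^ m := by positivity
  linarith

lemma mem_crowded_of_incidences {n m t : ℕ} (ht : 1 ≤ t) {T : Fin n → Finset (Fin m)}
    (hT : T ∈ sparseChoices n m t) (s : Finset (Fin m × Fin n))
    (hs : ∀ e ∈ s, 6 * t ≤ #(setsOf T e.1) ∧ e.2 ∈ setsOf T e.1)
    (hcard : #(s.image Prod.fst) + #(s.image Prod.snd) < #s) :
    ∃ j ∈ Finset.Icc 1 m, T ∈ crowded n m t j := by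
  set J := s.image Prod.fst with hJ
  have hJpos : 1 ≤ #J := by
    have : s.Nonempty := by rw [← Finset.card_pos]; omega
    exact (this.image _).card_pos
  have hJm : #J ≤ m := by simpa using Finset.card_le_univ J
  set E := {e ∈ J ×ˢ (univ : Finset (Fin n)) | e.1 ∈ T e.2} with hE
  have hsE : s ⊆ E := by
    intro e he
    have := (hs e he).2
    simp only [setsOf, Finset.mem_filter, Finset.mem_univ, true_and] at this
    exact Finset.mem_filter.2
      ⟨Finset.mem_product.2 ⟨Finset.mem_image_of_mem _ he, Finset.mem_univ _⟩, this⟩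
  have hEc : 6 * t * #J ≤ #E := by
    rw [Finset.card_eq_sum_card_fiberwise (f := Prod.fst) (t := J)
      (fun e he => by simp [hE] at he; exact he.1), mul_comm, ← smul_eq_mul]
    refine Finset.card_nsmul_le_sum _ _ _ fun i hi => ?_
    obtain ⟨e, he, hei⟩ := Finset.mem_image.1 hi
    have hi' : e.1 ∈ J := hei ▸ hi
    rw [← hei]
    refine (hs e he).1.trans ?_
    refine Finset.card_le_card_of_injOn (fun x => (e.1, x)) ?_ ?_
    · intro x hx
      simp only [setsOf, Finset.coe_filter, Finset.mem_univ, true_and, Set.mem_ofPred_eq] at hx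
      have hJx : (e.1, x) ∈ J ×ˢ (univ : Finset (Fin n)) :=
        Finset.mem_product.2 ⟨hi', Finset.mem_univ _⟩
      exact Finset.mem_coe.2 (Finset.mem_filter.2 ⟨Finset.mem_filter.2 ⟨hJx, hx⟩, rfl⟩)
    · intro x _ y _ hxy
      exact congrArg Prod.snd hxy
  have hsize : 2 * (#J + 1) ≤ 6 * t * #J := by nlinarith
  obtain ⟨G, R, hGE, hRE, hGR, hGc, hRc, hcov⟩ := exists_disjoint_covering_edges E s hsE #J
    (6 * t * #J - (#J + 1)) hcard (by omega) (by omega)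
  refine ⟨#J, Finset.mem_Icc.2 ⟨hJpos, hJm⟩, ?_⟩
  simp only [crowded, Finset.mem_biUnion, Finset.mem_powersetCard]
  refine ⟨J, ⟨Finset.subset_univ _, rfl⟩, G, ⟨fun e he => (Finset.mem_filter.1 (hGE he)).1, hGc⟩,
    R, ⟨fun e he => Finset.mem_product.2 ⟨?_, hcov (Finset.mem_image_of_mem _ he)⟩, hRc⟩, ?_⟩
  · exact (Finset.mem_product.1 (Finset.mem_filter.1 (hRE he)).1).1
  · refine Finset.mem_filter.2 ⟨hT, hGR, fun e he => ?_⟩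
    rcases Finset.mem_union.1 he with he | he
    · exact (Finset.mem_filter.1 (hGE he)).2
    · exact (Finset.mem_filter.1 (hRE he)).2

/-- For `t ≥ 55` and `m ≥ n ≥ t`, with probability at least `1 - 2^{-t}` over a random
`t`-sparse set system, one can delete one element `x_i` from each large set `S_i`
(`|S_i| ≥ 6t`) so that the sets `S_i \ {x_i}` become pairwise disjoint. -/
theorem large_sets_nearly_disjoint (t m n : ℕ) (ht : 55 ≤ t) (htn : t ≤ n) (hnm : n ≤ m) :
    1 - (2 : ℝ) ^ (-(t : ℤ)) ≤
      (((sparseChoices n m t).filter fun T =>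
          ∃ f : Fin m → Fin n,
            (∀ i, 6 * t ≤ (setsOf T i).card → f i ∈ setsOf T i) ∧
            ∀ i j, i ≠ j → 6 * t ≤ (setsOf T i).card → 6 * t ≤ (setsOf T j).card →
              Disjoint ((setsOf T i).erase (f i)) ((setsOf T j).erase (f j))).card : ℝ)
        / (sparseChoices n m t).card := by
  have hm : 0 < m := by omega
  have htm : t ≤ m := htn.trans hnm
  have : Nonempty (Fin n) := ⟨⟨0, by omega⟩⟩
  set Good : (Fin n → Finset (Fin m)) → Prop := fun T =>
    ∃ f : Fin m → Fin n,
      (∀ i, 6 * t ≤ (setsOf T i).card → f i ∈ setsOf T i) ∧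
      ∀ i j, i ≠ j → 6 * t ≤ (setsOf T i).card → 6 * t ≤ (setsOf T j).card →
        Disjoint ((setsOf T i).erase (f i)) ((setsOf T j).erase (f j)) with hGood
  have hbad : (sparseChoices n m t).filter (fun T => ¬ Good T) ⊆
      (Finset.Icc 1 m).biUnion fun j => crowded n m t j := by
    intro T hT
    obtain ⟨hT, hbad⟩ := Finset.mem_filter.1 hT
    rw [Finset.mem_biUnion]
    by_contra hcon
    refine hbad (exists_disjoint_erase (setsOf T) (fun i => 6 * t ≤ #(setsOf T i)) ?_ ?_)
    · intro i hi
      rw [← Finset.card_pos]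
      omega
    · intro s hs
      by_contra hlt
      exact hcon (mem_crowded_of_incidences (by omega) hT s hs (not_le.1 hlt))
  have hbadc : (#((sparseChoices n m t).filter fun T => ¬ Good T) : ℝ) ≤
      (1 / 2) ^ t * #(sparseChoices n m t) := by
    calc (#((sparseChoices n m t).filter fun T => ¬ Good T) : ℝ)
        ≤ ((∑ j ∈ Finset.Icc 1 m, #(crowded n m t j) : ℕ) : ℝ) := by
          exact_mod_cast (Finset.card_le_card hbad).trans Finset.card_biUnion_le
      _ ≤ ∑ j ∈ Finset.Icc 1 m, (1 / 2) ^ j * ((1 / 2) ^ t * #(sparseChoices n m t) : ℝ) := by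
          rw [Nat.cast_sum]
          refine Finset.sum_le_sum fun j hj => ?_
          obtain ⟨hj1, hjm⟩ := Finset.mem_Icc.1 hj
          have hsize : j + 1 ≤ 6 * t * j := by nlinarith
          refine (card_crowded_le hm htm hsize).trans ?_
          refine (mul_le_mul_of_nonneg_right ((choose_product_le hm hnm hjm hsize).trans
            (incidence_weight_le (by omega) hj1)) (Nat.cast_nonneg _)).trans (le_of_eq ?_)
          ring
      _ ≤ 1 * ((1 / 2) ^ t * #(sparseChoices n m t) : ℝ) := by
          rw [← Finset.sum_mul]
          exact mul_le_mul_of_nonneg_right (sum_half_pow_le_one m) (by positivity)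
      _ = _ := one_mul _
  have hpos : (0 : ℝ) < #(sparseChoices n m t) := by
    rw [sparseChoices_eq_piFinset, Fintype.card_piFinset]
    simp only [Finset.card_powersetCard, Finset.card_univ, Fintype.card_fin, Finset.prod_const]
    exact_mod_cast pow_pos (Nat.choose_pos htm) _
  have hsplit : (#((sparseChoices n m t).filter Good) : ℝ) +
      #((sparseChoices n m t).filter fun T => ¬ Good T) = #(sparseChoices n m t) := by
    exact_mod_cast Finset.card_filter_add_card_filter_not (s := sparseChoices n m t) Good
  have hzpow : (2 : ℝ) ^ (-(t : ℤ)) = (1 / 2) ^ t := by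
    rw [zpow_neg, zpow_natCast, one_div, inv_pow]
  rw [hzpow, le_div_iff₀ hpos]
  linarith
end

section
/- There is an absolute constant c > 0 with the following property. Let t ≥ 2 and let (X, Σ) be a t-sparse set system, and let I = {i : |S_i| ≥ 6t} index the large sets. Suppose there exists a choice of x_i ∈ S_i for each i ∈ I such that the sets {S_i \ {x_i} : i ∈ I} are pairwise disjoint. Then herdisc(Σ) ≤ max(c·√(t·log t), 2). -/
open Finset

/-- The symmetric lopsided Lovász local lemma in counting form: if conditioning on avoiding events outside
`Γ i` leaves the event `A i` with relative frequency at most `p`, and `4 p d ≤ 1` where `d` bounds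
the size of all `Γ i`, then all events can be avoided simultaneously. -/
theorem exists_forall_notMem_of_local_lemma {Ω ι : Type*} [Fintype Ω] [Nonempty Ω] [DecidableEq Ω]
    [Fintype ι] [DecidableEq ι] (A : ι → Finset Ω) (Γ : ι → Finset ι) (p : ℝ) (d : ℕ)
    (hp : 0 ≤ p) (hp2 : p < 1 / 2) (hpd : 4 * p * d ≤ 1) (hΓ : ∀ i, (Γ i).card ≤ d)
    (hA : ∀ i, ∀ F : Finset ι, Disjoint F (Γ i) →
      ((univ.filter fun ω => ω ∈ A i ∧ ∀ j ∈ F, ω ∉ A j).card : ℝ) ≤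
        p * (univ.filter fun ω => ∀ j ∈ F, ω ∉ A j).card) :
    ∃ ω, ∀ i, ω ∉ A i := by
  set N : Finset ι → Finset Ω := fun F => univ.filter fun ω => ∀ j ∈ F, ω ∉ A j with hN
  have mem_N : ∀ F ω, ω ∈ N F ↔ ∀ j ∈ F, ω ∉ A j := fun F ω => by simp [hN]
  have mem_AN : ∀ i F, (univ.filter fun ω => ω ∈ A i ∧ ∀ j ∈ F, ω ∉ A j) = A i ∩ N F := by
    intro i F; ext ω; simp [hN]
  have key : ∀ F : Finset ι, ∀ i, ((A i ∩ N F).card : ℝ) ≤ 2 * p * (N F).card := by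
    intro F
    induction F using Finset.strongInduction with
    | H F ih =>
      intro i
      have hfar : ((A i ∩ N (F \ Γ i)).card : ℝ) ≤ p * (N (F \ Γ i)).card := by
        have := hA i (F \ Γ i) sdiff_disjoint
        rwa [mem_AN] at this
      have hmono : ((A i ∩ N F).card : ℝ) ≤ (A i ∩ N (F \ Γ i)).card := by
        refine Nat.cast_le.2 (card_le_card (inter_subset_inter_left fun ω hω => ?_))
        rw [mem_N] at hω ⊢
        exact fun j hj => hω j (mem_sdiff.1 hj).1
      have hhalf : ((N (F \ Γ i)).card : ℝ) ≤ 2 * (N F).card := by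
        rcases (F ∩ Γ i).eq_empty_or_nonempty with h | h
        · rw [sdiff_eq_self_of_disjoint (disjoint_iff_inter_eq_empty.2 h)]
          linarith [Nat.cast_nonneg (α := ℝ) (N F).card]
        · have hss : F \ Γ i ⊂ F := by
            obtain ⟨j, hj⟩ := h
            rw [mem_inter] at hj
            exact (ssubset_iff_of_subset sdiff_subset).2 ⟨j, hj.1, fun h' => (mem_sdiff.1 h').2 hj.2⟩
          have hcov : N (F \ Γ i) ⊆ N F ∪ (F ∩ Γ i).biUnion fun j => A j ∩ N (F \ Γ i) := by
            intro ω hω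
            by_cases h' : ω ∈ N F
            · exact mem_union_left _ h'
            · refine mem_union_right _ ?_
              rw [mem_N] at h'
              push Not at h'
              obtain ⟨j, hj, hjA⟩ := h'
              have hjΓ : j ∈ Γ i := by
                by_contra hc
                exact (mem_N _ _).1 hω j (mem_sdiff.2 ⟨hj, hc⟩) hjA
              exact mem_biUnion.2 ⟨j, mem_inter.2 ⟨hj, hjΓ⟩, mem_inter.2 ⟨hjA, hω⟩⟩
          have h1 : ((N (F \ Γ i)).card : ℝ) ≤
              (N F).card + ∑ j ∈ F ∩ Γ i, ((A j ∩ N (F \ Γ i)).card : ℝ) := by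
            exact_mod_cast (card_le_card hcov).trans
              ((card_union_le _ _).trans (Nat.add_le_add_left card_biUnion_le _))
          have h2 : ∑ j ∈ F ∩ Γ i, ((A j ∩ N (F \ Γ i)).card : ℝ) ≤
              d * (2 * p * (N (F \ Γ i)).card) := by
            refine (sum_le_card_nsmul _ _ _ fun j _ => ih _ hss j).trans ?_
            rw [nsmul_eq_mul]
            have : ((F ∩ Γ i).card : ℝ) ≤ d :=
              Nat.cast_le.2 ((card_le_card inter_subset_right).trans (hΓ i))
            gcongr
          have h3 : 4 * p * d * ((N (F \ Γ i)).card : ℝ) ≤ 1 * (N (F \ Γ i)).card := by gcongr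
          linarith
      nlinarith
  have hpos : ∀ F : Finset ι, 0 < (N F).card := by
    intro F
    induction F using Finset.induction_on with
    | empty => simpa [hN] using Fintype.card_pos
    | insert i F hi ih =>
      have h1 : N F ⊆ N (insert i F) ∪ (A i ∩ N F) := by
        intro ω hω
        by_cases h : ω ∈ A i
        · exact mem_union_right _ (mem_inter.2 ⟨h, hω⟩)
        · refine mem_union_left _ ((mem_N _ _).2 fun j hj => ?_)
          rcases mem_insert.1 hj with rfl | hj
          · exact h
          · exact (mem_N _ _).1 hω j hj
      have h2 : ((N F).card : ℝ) ≤ (N (insert i F)).card + (A i ∩ N F).card := by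
        exact_mod_cast (card_le_card h1).trans (card_union_le _ _)
      have h3 := key F i
      have h4 : (0 : ℝ) < (N F).card := by exact_mod_cast ih
      have : (0 : ℝ) < (N (insert i F)).card := by nlinarith
      exact_mod_cast this
  obtain ⟨ω, hω⟩ := card_pos.1 (hpos univ)
  exact ⟨ω, fun i => (mem_N _ _).1 hω i (mem_univ i)⟩

/-- In a finite power, an event determined by the coordinates in `V` is independent of an event
determined by the coordinates outside `V`. -/
theorem card_inter_mul_card_eq_of_determined {α β : Type*} [Fintype α] [DecidableEq α] [Fintype β]
    [DecidableEq β] (V : Finset α) (A B : Finset (α → β))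
    (hA : ∀ ω ω', (∀ x ∈ V, ω x = ω' x) → ω ∈ A → ω' ∈ A)
    (hB : ∀ ω ω', (∀ x, x ∉ V → ω x = ω' x) → ω ∈ B → ω' ∈ B) :
    (A ∩ B).card * Fintype.card (α → β) = A.card * B.card := by
  rw [← card_univ, ← card_product, ← card_product]
  refine card_bij' (fun q _ => (V.piecewise q.1 q.2, V.piecewise q.2 q.1))
    (fun q _ => (V.piecewise q.1 q.2, V.piecewise q.2 q.1)) ?_ ?_ ?_ ?_
  · rintro ⟨a, b⟩ h
    simp only [mem_product, mem_inter, mem_univ, and_true] at h ⊢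
    exact ⟨hA a _ (fun x hx => by simp [hx]) h.1, hB a _ (fun x hx => by simp [hx]) h.2⟩
  · rintro ⟨a, b⟩ h
    simp only [mem_product, mem_inter, mem_univ, and_true] at h ⊢
    exact ⟨hA a _ (fun x hx => by simp [hx]) h.1, hB b _ (fun x hx => by simp [hx]) h.2⟩
  · rintro ⟨a, b⟩ _
    ext x <;> by_cases hx : x ∈ V <;> simp [hx]
  · rintro ⟨a, b⟩ _
    ext x <;> by_cases hx : x ∈ V <;> simp [hx]

/-- Exponential moment bound for a signed sum. -/
theorem sum_exp_signed_sum_le {α : Type*} [Fintype α] [DecidableEq α] (a : α → ℝ) :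
    ∑ ε : α → ℤˣ, Real.exp (∑ y, a y * ((ε y : ℤ) : ℝ)) ≤
      Fintype.card (α → ℤˣ) * Real.exp ((∑ y, a y ^ 2) / 2) := by
  have h1 : ∑ ε : α → ℤˣ, Real.exp (∑ y, a y * ((ε y : ℤ) : ℝ)) =
      ∏ y, ∑ u : ℤˣ, Real.exp (a y * ((u : ℤ) : ℝ)) := by
    rw [prod_univ_sum]
    simp only [Real.exp_sum, Fintype.piFinset_univ]
  have h2 : ∀ y, ∑ u : ℤˣ, Real.exp (a y * ((u : ℤ) : ℝ)) ≤ 2 * Real.exp (a y ^ 2 / 2) := by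
    intro y
    have : ∑ u : ℤˣ, Real.exp (a y * ((u : ℤ) : ℝ)) = 2 * Real.cosh (a y) := by
      rw [UnitsInt.univ, sum_pair (by decide), Real.cosh_eq]
      simp
      ring
    rw [this]
    have := Real.cosh_le_exp_half_sq (a y)
    linarith
  rw [h1]
  refine (prod_le_prod (fun y _ => sum_nonneg fun u _ => (Real.exp_pos _).le) fun y _ => h2 y).trans ?_
  rw [prod_mul_distrib, ← Real.exp_sum, ← sum_div]
  simp

/-- One-sided Chernoff bound for signed sums. -/
theorem card_signed_sum_gt_le {α : Type*} [Fintype α] [DecidableEq α] (a : α → ℝ) (W l : ℝ)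
    (hW : 0 < W) (hl : 0 ≤ l) (ha : ∑ y, a y ^ 2 ≤ W) :
    ((univ.filter fun ε : α → ℤˣ => l < ∑ y, a y * ((ε y : ℤ) : ℝ)).card : ℝ) ≤
      Fintype.card (α → ℤˣ) * Real.exp (-(l ^ 2 / (2 * W))) := by
  set θ := l / W with hθ
  have hθ0 : 0 ≤ θ := div_nonneg hl hW.le
  have h1 : ((univ.filter fun ε : α → ℤˣ => l < ∑ y, a y * ((ε y : ℤ) : ℝ)).card : ℝ) *
      Real.exp (θ * l) ≤ ∑ ε : α → ℤˣ, Real.exp (∑ y, (θ * a y) * ((ε y : ℤ) : ℝ)) := by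
    rw [← nsmul_eq_mul]
    refine (card_nsmul_le_sum _ (fun ε : α → ℤˣ => Real.exp (∑ y, (θ * a y) * ((ε y : ℤ) : ℝ))) _
      fun ε hε => ?_).trans
      (sum_le_sum_of_subset_of_nonneg (subset_univ _) fun _ _ _ => (Real.exp_pos _).le)
    have hε' := (mem_filter.1 hε).2
    simp only [mul_assoc, ← mul_sum]
    gcongr
  have h2 := h1.trans (sum_exp_signed_sum_le fun y => θ * a y)
  have h3 : Real.exp ((∑ y, (θ * a y) ^ 2) / 2) ≤
      Real.exp (-(l ^ 2 / (2 * W))) * Real.exp (θ * l) := by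
    rw [← Real.exp_add]
    refine Real.exp_le_exp.2 ?_
    have e1 : ∑ y, (θ * a y) ^ 2 = θ ^ 2 * ∑ y, a y ^ 2 := by simp only [mul_pow, mul_sum]
    have e2 : -(l ^ 2 / (2 * W)) + θ * l = θ ^ 2 * W / 2 := by
      rw [hθ]; field_simp; ring
    rw [e1, e2]
    gcongr
  refine le_of_mul_le_mul_right (h2.trans ?_) (Real.exp_pos (θ * l))
  rw [mul_assoc]
  gcongr

/-- Two-sided Chernoff bound for signed sums. -/
theorem card_abs_signed_sum_gt_le {α : Type*} [Fintype α] [DecidableEq α] (a : α → ℝ) (W l : ℝ)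
    (hW : 0 < W) (hl : 0 ≤ l) (ha : ∑ y, a y ^ 2 ≤ W) :
    ((univ.filter fun ε : α → ℤˣ => l < |∑ y, a y * ((ε y : ℤ) : ℝ)|).card : ℝ) ≤
      2 * Real.exp (-(l ^ 2 / (2 * W))) * Fintype.card (α → ℤˣ) := by
  have h1 := card_signed_sum_gt_le a W l hW hl ha
  have h2 := card_signed_sum_gt_le (fun y => -a y) W l hW hl (by simpa using ha)
  have h3 : (univ.filter fun ε : α → ℤˣ => l < |∑ y, a y * ((ε y : ℤ) : ℝ)|) ⊆
      (univ.filter fun ε : α → ℤˣ => l < ∑ y, a y * ((ε y : ℤ) : ℝ)) ∪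
      (univ.filter fun ε : α → ℤˣ => l < ∑ y, -a y * ((ε y : ℤ) : ℝ)) := by
    intro ε hε
    simpa [lt_abs] using hε
  have h4 : ((univ.filter fun ε : α → ℤˣ => l < |∑ y, a y * ((ε y : ℤ) : ℝ)|).card : ℝ) ≤
      (univ.filter fun ε : α → ℤˣ => l < ∑ y, a y * ((ε y : ℤ) : ℝ)).card +
      (univ.filter fun ε : α → ℤˣ => l < ∑ y, -a y * ((ε y : ℤ) : ℝ)).card := by
    exact_mod_cast (card_le_card h3).trans (card_union_le _ _)
  linarith

/-- The elements of a finite set can be paired up (with at most one left over) so that any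
coloring giving opposite signs within pairs has discrepancy at most one on the set. Here `r` sends
each element to a representative of its pair. -/
theorem exists_pairing {α : Type*} [DecidableEq α] (T : Finset α) :
    ∃ (r : α → α) (s : α → ℤˣ), (∀ x ∈ T, r x ∈ T) ∧
      (∀ y, (T.filter fun x => r x = y).card ≤ 2) ∧
      ∀ ε : α → ℤˣ, |∑ x ∈ T, ((s x * ε (r x) : ℤˣ) : ℤ)| ≤ 1 := by
  induction T using Finset.strongInduction with
  | H T ih =>
    by_cases hT : T.card ≤ 1
    · refine ⟨id, 1, fun x hx => hx, fun y => (card_filter_le _ _).trans (by omega), fun ε => ?_⟩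
      refine (abs_sum_le_sum_abs _ _).trans ?_
      have : ∀ u : ℤˣ, |(u : ℤ)| = 1 := fun u => Int.isUnit_iff_abs_eq.1 u.isUnit
      simp only [this, sum_const, nsmul_eq_mul, mul_one]
      exact_mod_cast hT
    · obtain ⟨a, ha, b, hb, hab⟩ := one_lt_card.1 (not_le.1 hT)
      obtain ⟨T', haT, hbT, rfl⟩ : ∃ T', a ∉ T' ∧ b ∉ T' ∧ T = insert a (insert b T') := by
        refine ⟨(T.erase a).erase b, by simp, by simp, ?_⟩
        rw [insert_erase (mem_erase.2 ⟨hab.symm, hb⟩), insert_erase ha]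
      have ha' : a ∉ insert b T' := by simp [hab, haT]
      obtain ⟨r, s, hr, hf, hs⟩ := ih T' (Finset.ssubset_of_subset_of_ssubset (subset_insert b T')
        (ssubset_insert ha'))
      have hne : ∀ x ∈ T', x ≠ a ∧ x ≠ b := fun x hx =>
        ⟨fun h => haT (h ▸ hx), fun h => hbT (h ▸ hx)⟩
      refine ⟨fun x => if x = a ∨ x = b then a else r x,
        fun x => if x = a then 1 else if x = b then -1 else s x, ?_, ?_, ?_⟩
      · intro x hx
        by_cases h : x = a ∨ x = b
        · simp [h]
        · have hxT : x ∈ T' := by simp only [mem_insert] at hx; tauto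
          simp [h, hr x hxT]
      · intro y
        by_cases hy : y = a
        · subst hy
          refine (card_le_card (t := {y, b}) fun x hx => ?_).trans card_le_two
          simp only [mem_filter, mem_insert, mem_singleton] at hx ⊢
          by_contra hc
          rw [if_neg hc] at hx
          exact haT (hx.2 ▸ hr x (by tauto))
        · refine (card_le_card fun x hx => ?_).trans (hf y)
          simp only [mem_filter, mem_insert] at hx ⊢
          by_cases hc : x = a ∨ x = b
          · rw [if_pos hc] at hx
            exact absurd hx.2.symm hy
          · rw [if_neg hc] at hx
            exact ⟨by tauto, hx.2⟩
      · intro ε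
        rw [sum_insert ha', sum_insert hbT]
        have : ∑ x ∈ T', (((if x = a then 1 else if x = b then -1 else s x) *
            ε (if x = a ∨ x = b then a else r x) : ℤˣ) : ℤ) =
            ∑ x ∈ T', ((s x * ε (r x) : ℤˣ) : ℤ) :=
          sum_congr rfl fun x hx => by simp [(hne x hx).1, (hne x hx).2]
        rw [this]
        simpa [hab.symm] using hs ε

/-- A simultaneous version of `exists_pairing` for pairwise disjoint sets. -/
theorem exists_pairing_of_disjoint {α ι : Type*} [Fintype α] [DecidableEq α] (T : ι → Finset α)
    (hT : ∀ i j, i ≠ j → Disjoint (T i) (T j)) :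
    ∃ (r : α → α) (s : α → ℤˣ), (∀ y, (univ.filter fun x => r x = y).card ≤ 2) ∧
      ∀ i, ∀ ε : α → ℤˣ, |∑ x ∈ T i, ((s x * ε (r x) : ℤˣ) : ℤ)| ≤ 1 := by
  classical
  choose r s hr hf hs using fun i => exists_pairing (T i)
  have huniq : ∀ i j x, x ∈ T i → x ∈ T j → i = j := by
    intro i j x hi hj
    by_contra h
    exact disjoint_left.1 (hT i j h) hi hj
  set R : α → α := fun x => if h : ∃ i, x ∈ T i then r h.choose x else x with hR
  have hRT : ∀ i, ∀ x ∈ T i, R x = r i x := by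
    intro i x hx
    have h : ∃ i, x ∈ T i := ⟨i, hx⟩
    rw [hR]
    simp only [dif_pos h, huniq _ _ x h.choose_spec hx]
  refine ⟨R, fun x => if h : ∃ i, x ∈ T i then s h.choose x else 1, fun y => ?_, fun i ε => ?_⟩
  · by_cases hy : ∃ i, y ∈ T i
    · obtain ⟨i, hi⟩ := hy
      refine (card_le_card fun x hx => ?_).trans (hf i y)
      have hx' := (mem_filter.1 hx).2
      have hxi : x ∈ T i := by
        by_cases h : ∃ j, x ∈ T j
        · obtain ⟨j, hj⟩ := h
          have : y ∈ T j := hx' ▸ hRT j x hj ▸ hr j x hj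
          rwa [huniq i j y hi this]
        · rw [hR] at hx'
          simp only [dif_neg h] at hx'
          rwa [hx']
      exact mem_filter.2 ⟨hxi, hRT i x hxi ▸ hx'⟩
    · refine (card_le_card (t := {y}) fun x hx => ?_).trans (by simp)
      have hx' := (mem_filter.1 hx).2
      by_cases h : ∃ j, x ∈ T j
      · obtain ⟨j, hj⟩ := h
        exact absurd ⟨j, hx' ▸ hRT j x hj ▸ hr j x hj⟩ hy
      · rw [hR] at hx'
        simp only [dif_neg h] at hx'
        simp [hx']
  · convert hs i ε using 3 with x hx
    have h : ∃ i, x ∈ T i := ⟨i, hx⟩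
    simp only [hRT i x hx, dif_pos h, huniq _ _ x h.choose_spec hx]

/-- Small sets of bounded degree have small discrepancy under some coloring of the form
`x ↦ s x * ε (r x)`, where `r` is at most two-to-one. -/
theorem exists_signs_of_sparse_small {α ι : Type*} [Fintype α] [DecidableEq α] [Fintype ι]
    [DecidableEq ι] (t : ℕ) (ht : 2 ≤ t) (B : ι → Finset α)
    (hdeg : ∀ x, (univ.filter fun i => x ∈ B i).card ≤ t) (hB : ∀ i, (B i).card ≤ 6 * t)
    (r : α → α) (s : α → ℤˣ) (hr : ∀ y, (univ.filter fun x => r x = y).card ≤ 2) :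
    ∃ ε : α → ℤˣ, ∀ i,
      ((|∑ x ∈ B i, ((s x * ε (r x) : ℤˣ) : ℤ)| : ℤ) : ℝ) ≤ 15 * Real.sqrt (t * Real.log t) := by
  have ht' : (2 : ℝ) ≤ t := by exact_mod_cast ht
  have hlog : 0 < Real.log t := Real.log_pos (by linarith)
  set l : ℝ := 15 * Real.sqrt (t * Real.log t) with hl
  have hl0 : 0 ≤ l := by positivity
  have hl2 : l ^ 2 = 225 * (t * Real.log t) := by
    rw [hl, mul_pow, Real.sq_sqrt (by positivity)]; norm_num
  set p : ℝ := 2 * Real.exp (-(l ^ 2 / (2 * (12 * t)))) with hp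
  have hp0 : 0 < p := by positivity
  have hpt : p * t ^ 9 ≤ 2 := by
    have h1 : Real.exp (-(l ^ 2 / (2 * (12 * t)))) ≤ Real.exp (-(9 * Real.log t)) := by
      refine Real.exp_le_exp.2 (neg_le_neg ?_)
      rw [hl2, le_div_iff₀ (by positivity)]
      nlinarith [mul_pos (show (0 : ℝ) < t by linarith) hlog]
    have h2 : Real.exp (9 * Real.log t) = (t : ℝ) ^ 9 := by
      rw [show (9 : ℝ) * Real.log t = Real.log ((t : ℝ) ^ 9) by rw [Real.log_pow]; norm_num]
      exact Real.exp_log (by positivity)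
    have h3 : Real.exp (-(9 * Real.log t)) * (t : ℝ) ^ 9 = 1 := by
      rw [← h2, ← Real.exp_add]; simp
    have h4 : Real.exp (-(l ^ 2 / (2 * (12 * t)))) * (t : ℝ) ^ 9 ≤ 1 := by
      rw [← h3]; gcongr
    rw [hp]; linarith
  have hpd : 4 * p * ((12 * t ^ 2 : ℕ) : ℝ) ≤ 1 := by
    have h7 : (2 : ℝ) ^ 7 ≤ (t : ℝ) ^ 7 := by gcongr
    have : p * (t : ℝ) ^ 2 * 2 ^ 7 ≤ p * (t : ℝ) ^ 2 * (t : ℝ) ^ 7 := by gcongr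
    have h9 : p * (t : ℝ) ^ 2 * (t : ℝ) ^ 7 = p * t ^ 9 := by ring
    push_cast
    nlinarith
  have hp2 : p < 1 / 2 := by
    push_cast at hpd
    nlinarith
  set V : ι → Finset α := fun i => (B i).image r with hV
  set bad : ι → Finset (α → ℤˣ) := fun i =>
    univ.filter fun ε => l < ((|∑ x ∈ B i, ((s x * ε (r x) : ℤˣ) : ℤ)| : ℤ) : ℝ) with hbad
  have hdet : ∀ i ε ε', (∀ y ∈ V i, ε y = ε' y) → ε ∈ bad i → ε' ∈ bad i := by
    intro i ε ε' h hε
    have : ∑ x ∈ B i, ((s x * ε' (r x) : ℤˣ) : ℤ) = ∑ x ∈ B i, ((s x * ε (r x) : ℤˣ) : ℤ) :=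
      sum_congr rfl fun x hx => by rw [h (r x) (mem_image_of_mem r hx)]
    simp only [hbad, mem_filter, mem_univ, true_and] at hε ⊢
    rwa [this]
  have hprob : ∀ i, ((bad i).card : ℝ) ≤ p * Fintype.card (α → ℤˣ) := by
    intro i
    set a : α → ℝ := fun y => ∑ x ∈ B i with r x = y, ((s x : ℤ) : ℝ) with ha
    have hsum : ∀ ε : α → ℤˣ, ((∑ x ∈ B i, ((s x * ε (r x) : ℤˣ) : ℤ) : ℤ) : ℝ) =
        ∑ y, a y * ((ε y : ℤ) : ℝ) := by
      intro ε
      rw [← sum_fiberwise (B i) r]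
      push_cast
      refine sum_congr rfl fun y _ => ?_
      rw [ha, sum_mul]
      exact sum_congr rfl fun x hx => by rw [(mem_filter.1 hx).2]
    have habs : ∀ y, |a y| ≤ ((B i).filter fun x => r x = y).card := by
      intro y
      refine (abs_sum_le_sum_abs _ _).trans ?_
      have : ∀ u : ℤˣ, |((u : ℤ) : ℝ)| = 1 := fun u => by
        rcases Int.units_eq_one_or u with rfl | rfl <;> simp
      simp [this]
    have hsq : ∑ y, a y ^ 2 ≤ 12 * t := by
      have h1 : ∀ y, a y ^ 2 ≤ 2 * (((B i).filter fun x => r x = y).card : ℝ) := by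
        intro y
        have h2 : (((B i).filter fun x => r x = y).card : ℝ) ≤ 2 := by
          exact_mod_cast (card_le_card (filter_subset_filter _ (subset_univ _))).trans (hr y)
        rw [← sq_abs]
        nlinarith [habs y, abs_nonneg (a y)]
      refine (sum_le_sum fun y _ => h1 y).trans ?_
      rw [← mul_sum]
      have h3 : ∑ y, (((B i).filter fun x => r x = y).card : ℝ) = (B i).card := by
        exact_mod_cast (card_eq_sum_card_fiberwise (f := r) (s := B i) (t := univ)
          fun _ _ => mem_coe.2 (mem_univ _)).symm
      have h4 : ((B i).card : ℝ) ≤ 6 * t := by exact_mod_cast hB i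
      rw [h3]; linarith
    have := card_abs_signed_sum_gt_le a (12 * t) l (by positivity) hl0 hsq
    simp only [← hsum, ← Int.cast_abs] at this
    exact this
  obtain ⟨ε, hε⟩ := exists_forall_notMem_of_local_lemma bad
    (fun i => univ.filter fun j => ¬ Disjoint (V j) (V i)) p (12 * t ^ 2) hp0.le hp2 hpd
    (fun i => by
      have hsub : (univ.filter fun j => ¬ Disjoint (V j) (V i)) ⊆
          (B i).biUnion fun x => (univ.filter fun x' => r x' = r x).biUnion fun x' =>
            univ.filter fun j => x' ∈ B j := by
        intro j hj
        obtain ⟨y, hyj, hyi⟩ := not_disjoint_iff.1 (mem_filter.1 hj).2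
        obtain ⟨x', hx', rfl⟩ := mem_image.1 hyj
        obtain ⟨x, hx, hxx⟩ := mem_image.1 hyi
        simp only [mem_biUnion, mem_filter, mem_univ, true_and]
        exact ⟨x, hx, x', hxx.symm, hx'⟩
      calc _ ≤ _ := card_le_card hsub
        _ ≤ (B i).card * (2 * t) := card_biUnion_le_card_mul _ _ _ fun x _ =>
            (card_biUnion_le_card_mul _ _ _ fun x' _ => hdeg x').trans
              (Nat.mul_le_mul_right t (hr (r x)))
        _ ≤ 6 * t * (2 * t) := Nat.mul_le_mul_right _ (hB i)
        _ = 12 * t ^ 2 := by ring)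
    (fun i F hF => by
      have hind := card_inter_mul_card_eq_of_determined (V i) (bad i)
        (univ.filter fun ε => ∀ j ∈ F, ε ∉ bad j) (hdet i) (by
          intro ε ε' h hε
          simp only [mem_filter, mem_univ, true_and] at hε ⊢
          intro j hj hc
          refine hε j hj (hdet j ε' ε (fun y hy => (h y fun hyi => ?_).symm) hc)
          exact disjoint_left.1 hF hj
            (mem_filter.2 ⟨mem_univ _, not_disjoint_iff.2 ⟨y, hy, hyi⟩⟩))
      have heq : (univ.filter fun ε => ε ∈ bad i ∧ ∀ j ∈ F, ε ∉ bad j) =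
          bad i ∩ univ.filter fun ε => ∀ j ∈ F, ε ∉ bad j := by
        ext ε; simp
      rw [heq]
      have hcard : (0 : ℝ) < Fintype.card (α → ℤˣ) := by exact_mod_cast Fintype.card_pos
      refine le_of_mul_le_mul_right ?_ hcard
      rw [← Nat.cast_mul, hind, Nat.cast_mul, mul_right_comm]
      exact mul_le_mul_of_nonneg_right (hprob i) (Nat.cast_nonneg _))
  refine ⟨ε, fun i => ?_⟩
  have := hε i
  simpa [hbad] using this

/-- If a `t`-sparse set system admits a choice of one element `x_i` in each large set
(`|S_i| ≥ 6t`) whose deletion makes the large sets pairwise disjoint, then its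
hereditary discrepancy is at most `max (c √(t log t)) 2`. -/
theorem herdisc_of_large_sets_nearly_disjoint :
    ∃ c : ℝ, 0 < c ∧ ∀ t n m : ℕ, 2 ≤ t → ∀ S : Fin m → Finset (Fin n),
      (∀ x : Fin n, (Finset.univ.filter fun i : Fin m => x ∈ S i).card ≤ t) →
      (∃ f : Fin m → Fin n,
          (∀ i, 6 * t ≤ (S i).card → f i ∈ S i) ∧
          ∀ i j, i ≠ j → 6 * t ≤ (S i).card → 6 * t ≤ (S j).card →
            Disjoint ((S i).erase (f i)) ((S j).erase (f j))) →
      (herdisc S : ℝ) ≤ max (c * Real.sqrt (t * Real.log t)) 2 := by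
  refine ⟨15, by norm_num, fun t n m ht S hdeg ⟨f, hf, hdisj⟩ => ?_⟩
  set M : ℝ := max (15 * Real.sqrt (t * Real.log t)) 2 with hM
  have hM0 : 0 ≤ M := le_max_of_le_right (by norm_num)
  refine (Nat.le_floor_iff hM0).1 (Finset.sup_le fun Y _ => Nat.sInf_le ?_)
  set T : Fin m → Finset (Fin n) := fun i =>
    if 6 * t ≤ (S i).card then (S i).erase (f i) ∩ Y else ∅ with hT
  have hTdisj : ∀ i j, i ≠ j → Disjoint (T i) (T j) := by
    intro i j hij
    by_cases hi : 6 * t ≤ (S i).card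
    · by_cases hj : 6 * t ≤ (S j).card
      · simp only [hT, if_pos hi, if_pos hj]
        exact (hdisj i j hij hi hj).mono inter_subset_left inter_subset_left
      · simp [hT, hj]
    · simp [hT, hi]
  obtain ⟨r, s, hr, hs⟩ := exists_pairing_of_disjoint T hTdisj
  set B : Fin m → Finset (Fin n) := fun i =>
    if 6 * t ≤ (S i).card then ∅ else S i ∩ Y with hB
  have hBS : ∀ i, B i ⊆ S i := by
    intro i
    by_cases hi : 6 * t ≤ (S i).card
    · simp [hB, hi]
    · simp only [hB, if_neg hi]
      exact inter_subset_left
  obtain ⟨ε, hε⟩ := exists_signs_of_sparse_small t ht B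
    (fun x => (card_le_card (monotone_filter_right _ fun i _ hx => hBS i hx)).trans (hdeg x))
    (fun i => by
      by_cases hi : 6 * t ≤ (S i).card
      · simp [hB, hi]
      · exact (card_le_card (hBS i)).trans (not_le.1 hi).le) r s hr
  refine ⟨fun x => ((s x * ε (r x) : ℤˣ) : ℤ), fun x => ?_, fun i => Nat.le_floor ?_⟩
  · exact Int.isUnit_iff.1 (Units.isUnit _)
  rw [Nat.cast_natAbs]
  by_cases hi : 6 * t ≤ (S i).card
  · refine le_trans ?_ (le_max_right _ _)
    have h1 := hs i ε
    simp only [hT, if_pos hi] at h1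
    rw [erase_inter] at h1
    have h2 : |∑ x ∈ S i ∩ Y, ((s x * ε (r x) : ℤˣ) : ℤ)| ≤ 2 := by
      by_cases hmem : f i ∈ S i ∩ Y
      · rw [← add_sum_erase _ _ hmem]
        have h3 : |((s (f i) * ε (r (f i)) : ℤˣ) : ℤ)| = 1 :=
          Int.isUnit_iff_abs_eq.1 (Units.isUnit _)
        exact (abs_add_le _ _).trans (by linarith)
      · rw [erase_eq_of_notMem hmem] at h1
        linarith
    exact_mod_cast h2
  · refine le_trans ?_ (le_max_left _ _)
    have := hε i
    simpa only [hB, if_neg hi] using this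
end

section
/- Let G be a bipartite graph with parts X and V that contains no cycles, and suppose every vertex v ∈ V has at least one neighbor. Then there exists a choice of a neighbor x_v ∈ Γ(v) for each v ∈ V such that the sets {Γ(v) \ {x_v} : v ∈ V} are pairwise disjoint. -/
/-- Every forest can be rooted: there is a parent function such that the two ends of each edge
are parent and child. -/
theorem SimpleGraph.IsAcyclic.exists_parent {V : Type*} {G : SimpleGraph V} (hG : G.IsAcyclic) :
    ∃ parent : V → V, ∀ a b, G.Adj a b → parent a = b ∨ parent b = a := by
  have hpath (a : V) : ∃ p : G.Walk a (G.connectedComponentMk a).out, p.IsPath :=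
    (SimpleGraph.ConnectedComponent.exact (Quot.out_eq (G.connectedComponentMk a)).symm).exists_isPath
  choose p hp using hpath
  refine ⟨fun a => (p a).snd, fun a b hab => or_iff_not_imp_left.mpr fun hne => ?_⟩
  have hb : b ∉ (p a).support := fun h => hne (hG.eq_snd_of_adj_start (hp a) hab h).symm
  have hroot : G.connectedComponentMk a = G.connectedComponentMk b :=
    SimpleGraph.ConnectedComponent.sound hab.reachable
  have hsnd : ∀ q : G.Walk b (G.connectedComponentMk b).out, q.IsPath → q.snd = a := by
    rw [← hroot]
    intro q hq
    have h := (hG.subsingleton_path b _).elim ⟨q, hq⟩ ⟨SimpleGraph.Walk.cons hab.symm (p a), (hp a).cons hb⟩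
    rw [Subtype.mk.inj h, SimpleGraph.Walk.snd_cons]
  exact hsnd (p b) (hp b)

/-- If `G` is an acyclic bipartite graph with parts `X` and `V` in which every `v ∈ V`
has a neighbor, then one can choose a neighbor `x_v ∈ Γ(v)` for each `v ∈ V` so that
the sets `Γ(v) \ {x_v}` are pairwise disjoint. -/
theorem forest_choice_disjoint {X V : Type*} (G : SimpleGraph (X ⊕ V))
    (hbip : ∀ a b, G.Adj a b →
      (∃ x v, a = Sum.inl x ∧ b = Sum.inr v) ∨ (∃ v x, a = Sum.inr v ∧ b = Sum.inl x))
    (hacyc : G.IsAcyclic)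
    (hne : ∀ v : V, ∃ x : X, G.Adj (Sum.inr v) (Sum.inl x)) :
    ∃ f : V → X, (∀ v, G.Adj (Sum.inr v) (Sum.inl (f v))) ∧
      ∀ v w : V, v ≠ w →
        Disjoint ({x : X | G.Adj (Sum.inr v) (Sum.inl x)} \ {f v})
          ({x : X | G.Adj (Sum.inr w) (Sum.inl x)} \ {f w}) := by
  obtain ⟨parent, hparent⟩ := hacyc.exists_parent
  have hchoice (v : V) : ∃ x : X, G.Adj (Sum.inr v) (Sum.inl x) ∧
      ∀ y : X, G.Adj (Sum.inr v) (Sum.inl y) → y ≠ x → parent (Sum.inl y) = Sum.inr v := by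
    by_cases h : ∃ x : X, G.Adj (Sum.inr v) (Sum.inl x) ∧ parent (Sum.inr v) = Sum.inl x
    · obtain ⟨x, hx, hpx⟩ := h
      refine ⟨x, hx, fun y hy hyx => (hparent _ _ hy).resolve_left fun hpy => hyx ?_⟩
      exact Sum.inl_injective (hpy.symm.trans hpx)
    · obtain ⟨x, hx⟩ := hne v
      exact ⟨x, hx, fun y hy _ => (hparent _ _ hy).resolve_left fun hpy => h ⟨y, hy, hpy⟩⟩
  choose f hf hchild using hchoice
  refine ⟨f, hf, fun v w hvw => Set.disjoint_left.mpr ?_⟩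
  rintro x ⟨hxv, hxfv⟩ ⟨hxw, hxfw⟩
  exact hvw (Sum.inr_injective ((hchild v x hxv hxfv).symm.trans (hchild w x hxw hxfw)))
end

section
/- Let t ≥ 2 and m ≥ n ≥ t, and let G = (X, V, E) be a random left t-regular bipartite graph with |X| = n, |V| = m. Let V' = {v ∈ V : deg(v) ≥ 6t} and let G' be the induced bipartite subgraph on (X, V'). Then Pr[girth(G') = 4] ≤ t⁴·e^{−t}. -/
open Finset

open scoped Classical

/-- The sample space of a random left `t`-regular bipartite graph on parts
`X = Fin n` and `V = Fin m`: each `x ∈ X` independently gets a uniformly random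
`t`-element neighborhood `Γ x ⊆ V`. The uniform distribution on this finite set
is the distribution of the random graph. -/
noncomputable def regChoices (n m t : ℕ) : Finset (Fin n → Finset (Fin m)) :=
  Finset.univ.filter fun Γ => ∀ x, (Γ x).card = t

/-- The degree of a right vertex `v ∈ V`. -/
noncomputable def rightDeg {n m : ℕ} (Γ : Fin n → Finset (Fin m)) (v : Fin m) : ℕ :=
  (Finset.univ.filter fun x : Fin n => v ∈ Γ x).card

/-- The bipartite subgraph `G'` induced on `(X, V')`, where
`V' = {v ∈ V : deg(v) ≥ 6t}`: `x ∈ X` and `v ∈ V` are adjacent iff `v ∈ Γ x` and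
`v ∈ V'`. -/
noncomputable def inducedGraph {n m : ℕ} (Γ : Fin n → Finset (Fin m)) (t : ℕ) :
    SimpleGraph (Fin n ⊕ Fin m) :=
  SimpleGraph.fromRel fun a b =>
    ∃ x v, a = Sum.inl x ∧ b = Sum.inr v ∧ v ∈ Γ x ∧ 6 * t ≤ rightDeg Γ v

/-- A `4`-cycle in the induced graph yields two distinct left vertices sharing two distinct
right vertices of degree at least `6 * t`. -/
theorem exists_common_neighbors_of_girth_eq_four {n m t : ℕ} {Γ : Fin n → Finset (Fin m)}
    (h : (inducedGraph Γ t).girth = 4) :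
    ∃ x y : Fin n, ∃ u v : Fin m, x ≠ y ∧ u ≠ v ∧ {u, v} ⊆ Γ x ∧ {u, v} ⊆ Γ y ∧
      6 * t ≤ rightDeg Γ u := by
  have hac : ¬ (inducedGraph Γ t).IsAcyclic := by
    rw [← SimpleGraph.girth_eq_zero]; omega
  obtain ⟨a, w, hw, hlen⟩ := SimpleGraph.exists_girth_eq_length.2 hac
  rw [h] at hlen
  have hadj : ∀ i < 4, (inducedGraph Γ t).Adj (w.getVert i) (w.getVert (i + 1)) :=
    fun i hi => w.adj_getVert_succ (hlen ▸ hi)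
  have hinj := hw.getVert_injOn
  have h13 : w.getVert 1 ≠ w.getVert 3 := fun e => by
    have := hinj (by simp; omega) (by simp; omega) e
    omega
  have h24 : w.getVert 2 ≠ w.getVert 4 := fun e => by
    have := hinj (by simp; omega) (by simp; omega) e
    omega
  have h0 : w.getVert 0 = w.getVert 4 := by
    rw [SimpleGraph.Walk.getVert_zero, hlen, SimpleGraph.Walk.getVert_length]
  have a0 := hadj 0 (by norm_num)
  have a1 := hadj 1 (by norm_num)
  have a2 := hadj 2 (by norm_num)
  have a3 := hadj 3 (by norm_num)
  rw [h0] at a0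
  norm_num at a0 a1 a2 a3
  generalize w.getVert 1 = p at *
  generalize w.getVert 2 = q at *
  generalize w.getVert 3 = r at *
  generalize w.getVert 4 = s at *
  simp only [inducedGraph, SimpleGraph.fromRel_adj] at a0 a1 a2 a3
  rcases p with p | p <;> rcases q with q | q <;> rcases r with r | r <;>
    rcases s with s | s <;> simp at a0 a1 a2 a3 h13 h24
  · exact ⟨p, r, q, s, h13, h24, by grind, by grind, a1.2⟩
  · exact ⟨q, s, p, r, h24, h13, by grind, by grind, a1.2⟩

theorem regChoices_eq_piFinset (n m t : ℕ) :
    regChoices n m t = Fintype.piFinset fun _ => powersetCard t univ := by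
  ext Γ
  simp [regChoices]

theorem card_regChoices (n m t : ℕ) : (regChoices n m t).card = m.choose t ^ n := by
  simp [regChoices_eq_piFinset]

/-- Expected value of `1 + [u ∈ S]` for a random `t`-subset `S`. -/
theorem sum_powersetCard_one_add {m t : ℕ} (ht : 1 ≤ t) (htm : t ≤ m) (u : Fin m) :
    ∑ S ∈ powersetCard t (univ : Finset (Fin m)), (if u ∈ S then (2 : ℝ) else 1) =
      m.choose t * (1 + t / m) := by
  have hcard := card_filter_powersetCard_subset {u} (univ : Finset (Fin m)) t (subset_univ _)
    (by simpa using ht)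
  have hc := Nat.choose_mul (n := m) ht
  simp only [singleton_subset_iff, card_univ, Fintype.card_fin, card_singleton,
    Nat.choose_one_right] at hcard hc
  have hsum : ∀ S : Finset (Fin m),
      (if u ∈ S then (2 : ℝ) else 1) = 1 + if u ∈ S then 1 else 0 := by
    intro S; split_ifs <;> norm_num
  have hc' : (m.choose t : ℝ) * t = m * (m - 1).choose (t - 1) := by exact_mod_cast hc
  have hm : (m : ℝ) ≠ 0 := by norm_cast; omega
  simp only [hsum, sum_add_distrib, sum_boole, sum_const, card_powersetCard, hcard, card_univ,
    Fintype.card_fin]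
  field_simp
  simp
  linarith

/-- A random `t`-subset contains two given points with probability at most `(t / m) ^ 2`. -/
theorem card_filter_pair_subset_le {m t : ℕ} (ht : 2 ≤ t) (htm : t ≤ m) {u v : Fin m}
    (huv : u ≠ v) :
    (((powersetCard t (univ : Finset (Fin m))).filter ({u, v} ⊆ ·)).card : ℝ) ≤
      m.choose t * (t / m) ^ 2 := by
  rw [card_filter_powersetCard_subset {u, v} (univ : Finset (Fin m)) t (subset_univ _)
    (by rwa [card_pair huv])]
  simp only [card_univ, Fintype.card_fin, card_pair huv]
  have h1 := Nat.choose_mul (n := m) (show 1 ≤ t by omega)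
  have h2 := Nat.choose_mul (n := m - 1) (k := t - 1) (s := 1) (by omega)
  simp only [Nat.choose_one_right, Nat.sub_sub, Nat.reduceAdd] at h1 h2
  have hm : (1 : ℝ) < m := by norm_cast; omega
  have h1' : (m.choose t : ℝ) * t = m * (m - 1).choose (t - 1) := by exact_mod_cast h1
  have h2' : ((m - 1).choose (t - 1) : ℝ) * (t - 1) = (m - 1) * (m - 2).choose (t - 2) := by
    have := congrArg (Nat.cast : ℕ → ℝ) h2
    push_cast [Nat.cast_sub (show 1 ≤ t by omega), Nat.cast_sub (show 1 ≤ m by omega)] at this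
    exact this
  have htm' : (t : ℝ) ≤ m := by exact_mod_cast htm
  have h3 : (m : ℝ) * (m - 2).choose (t - 2) ≤ t * (m - 1).choose (t - 1) := by
    refine le_of_mul_le_mul_left ?_ (sub_pos.2 hm)
    have hc : (0 : ℝ) ≤ (m - 1).choose (t - 1) := Nat.cast_nonneg _
    nlinarith
  rw [div_pow, ← mul_div_assoc, le_div_iff₀ (by positivity)]
  nlinarith

/-- Exponential-moment bound for two left vertices sharing two right vertices, one of which has
degree at least `6 * t`. -/
theorem card_filter_common_neighbors_le {n m t : ℕ} (ht : 2 ≤ t) (htn : t ≤ n) (hnm : n ≤ m)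
    {x y : Fin n} {u v : Fin m} (hxy : x ≠ y) (huv : u ≠ v) :
    (((regChoices n m t).filter fun Γ =>
      {u, v} ⊆ Γ x ∧ {u, v} ⊆ Γ y ∧ 6 * t ≤ rightDeg Γ u).card : ℝ) * 2 ^ (6 * t) ≤
      (m.choose t : ℝ) ^ n * (4 * (t / m) ^ 4 * Real.exp t) := by
  set N := (m.choose t : ℝ)
  let f : Fin n → Finset (Fin m) → ℝ := fun z S =>
    if z = x ∨ z = y then (if {u, v} ⊆ S then 2 else 0) else if u ∈ S then 2 else 1
  have hf : ∀ z S, 0 ≤ f z S := by intro z S; simp only [f]; split_ifs <;> norm_num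
  have hlow : ∀ Γ : Fin n → Finset (Fin m), {u, v} ⊆ Γ x → {u, v} ⊆ Γ y → 6 * t ≤ rightDeg Γ u →
      (2 : ℝ) ^ (6 * t) ≤ ∏ z, f z (Γ z) := by
    intro Γ hx hy hd
    have : ∀ z, f z (Γ z) = if u ∈ Γ z then 2 else 1 := by
      intro z; simp only [f]; grind
    simp only [this, prod_ite, prod_const, one_pow, mul_one]
    exact pow_le_pow_right₀ (by norm_num) hd
  calc _ = ∑ Γ ∈ (regChoices n m t).filter fun Γ =>
        {u, v} ⊆ Γ x ∧ {u, v} ⊆ Γ y ∧ 6 * t ≤ rightDeg Γ u, (2 : ℝ) ^ (6 * t) := by simp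
    _ ≤ ∑ Γ ∈ (regChoices n m t).filter fun Γ =>
        {u, v} ⊆ Γ x ∧ {u, v} ⊆ Γ y ∧ 6 * t ≤ rightDeg Γ u, ∏ z, f z (Γ z) :=
      sum_le_sum fun Γ hΓ => by
        obtain ⟨-, hx, hy, hd⟩ := mem_filter.1 hΓ
        exact hlow Γ hx hy hd
    _ ≤ ∑ Γ ∈ regChoices n m t, ∏ z, f z (Γ z) :=
      sum_le_sum_of_subset_of_nonneg (filter_subset _ _) fun Γ _ _ => prod_nonneg fun z _ => hf z _
    _ = ∏ z, ∑ S ∈ powersetCard t univ, f z S := by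
      rw [regChoices_eq_piFinset, prod_univ_sum]
    _ ≤ ∏ z : Fin n, if z = x ∨ z = y then 2 * (N * (t / m) ^ 2) else N * Real.exp (t / m) := by
      refine prod_le_prod (fun z _ => sum_nonneg fun S _ => hf z S) fun z _ => ?_
      by_cases hz : z = x ∨ z = y
      · simp only [f, if_pos hz, ← sum_filter, sum_const, nsmul_eq_mul]
        linarith [card_filter_pair_subset_le ht (htn.trans hnm) huv]
      · simp only [f, if_neg hz]
        rw [sum_powersetCard_one_add (by omega) (htn.trans hnm)]
        gcongr
        linarith [Real.add_one_le_exp ((t : ℝ) / m)]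
    _ = (2 * (N * (t / m) ^ 2)) ^ 2 * (N * Real.exp (t / m)) ^ (n - 2) := by
      have hpair : (univ.filter fun z => z = x ∨ z = y) = {x, y} := by ext; simp
      have hcompl : (univ.filter fun z => ¬ (z = x ∨ z = y)) = {x, y}ᶜ := by ext; simp
      rw [prod_ite, prod_const, prod_const, hpair, hcompl, card_compl, card_pair hxy,
        Fintype.card_fin]
    _ = N ^ n * (4 * (t / m) ^ 4 * Real.exp (↑(n - 2) * (t / m))) := by
      rw [mul_pow N, ← Real.exp_nat_mul]
      obtain ⟨k, rfl⟩ := Nat.exists_eq_add_of_le' (ht.trans htn)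
      simp only [Nat.add_sub_cancel]
      ring
    _ ≤ _ := by
      have hm : (0 : ℝ) < m := by norm_cast; omega
      have hnm' : ((n - 2 : ℕ) : ℝ) ≤ m := by norm_cast; omega
      gcongr
      calc ((n - 2 : ℕ) : ℝ) * (t / m) ≤ m * (t / m) := by gcongr
        _ = t := by field_simp

/-- For `t ≥ 2` and `m ≥ n ≥ t`, the probability that the induced subgraph `G'`
on the high-degree right vertices has girth `4` is at most `t⁴ e^{-t}`. -/
theorem prob_girth_four (t m n : ℕ) (ht : 2 ≤ t) (htn : t ≤ n) (hnm : n ≤ m) :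
    (((regChoices n m t).filter fun Γ => (inducedGraph Γ t).girth = 4).card : ℝ)
        / (regChoices n m t).card
      ≤ (t : ℝ) ^ 4 * Real.exp (-(t : ℝ)) := by
  have hm : (0 : ℝ) < m := by norm_cast; omega
  have hN : (0 : ℝ) < m.choose t := by exact_mod_cast Nat.choose_pos (htn.trans hnm)
  set N := (m.choose t : ℝ) with hNdef
  let I : Finset ((Fin n × Fin n) × (Fin m × Fin m)) :=
    univ.filter fun p => p.1.1 ≠ p.1.2 ∧ p.2.1 ≠ p.2.2
  have hI : (I.card : ℝ) ≤ m ^ 4 := by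
    have : I.card ≤ m ^ 4 := calc
      I.card ≤ (n * n) * (m * m) := by
        simpa [I] using card_le_univ I
      _ ≤ (m * m) * (m * m) := by gcongr
      _ = m ^ 4 := by ring
    exact_mod_cast this
  let B : (Fin n × Fin n) × (Fin m × Fin m) → Finset (Fin n → Finset (Fin m)) := fun p =>
    (regChoices n m t).filter fun Γ =>
      {p.2.1, p.2.2} ⊆ Γ p.1.1 ∧ {p.2.1, p.2.2} ⊆ Γ p.1.2 ∧ 6 * t ≤ rightDeg Γ p.2.1
  have hsub : ((regChoices n m t).filter fun Γ => (inducedGraph Γ t).girth = 4) ⊆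
      I.biUnion B := by
    intro Γ hΓ
    obtain ⟨hΓ, hg⟩ := mem_filter.1 hΓ
    obtain ⟨x, y, u, v, hxy, huv, hx, hy, hd⟩ := exists_common_neighbors_of_girth_eq_four hg
    exact mem_biUnion.2 ⟨((x, y), (u, v)), mem_filter.2 ⟨mem_univ _, hxy, huv⟩,
      mem_filter.2 ⟨hΓ, hx, hy, hd⟩⟩
  have hPsum := (card_le_card hsub).trans card_biUnion_le
  rw [← Nat.cast_le (α := ℝ), Nat.cast_sum] at hPsum
  set P : ℝ := (((regChoices n m t).filter fun Γ => (inducedGraph Γ t).girth = 4).card : ℝ)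
  have hP : P * 2 ^ (6 * t) ≤ N ^ n * (4 * t ^ 4 * Real.exp t) := calc
    P * 2 ^ (6 * t) ≤ (∑ p ∈ I, ((B p).card : ℝ)) * 2 ^ (6 * t) := by
      gcongr
    _ ≤ ∑ p ∈ I, N ^ n * (4 * (t / m) ^ 4 * Real.exp t) := by
      rw [sum_mul]
      refine sum_le_sum fun p hp => ?_
      obtain ⟨-, hxy, huv⟩ := mem_filter.1 hp
      exact card_filter_common_neighbors_le ht htn hnm hxy huv
    _ ≤ m ^ 4 * (N ^ n * (4 * (t / m) ^ 4 * Real.exp t)) := by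
      rw [sum_const, nsmul_eq_mul]
      gcongr
    _ = _ := by field_simp
  have hexp : 4 * Real.exp t ≤ Real.exp (-(t : ℝ)) * 2 ^ (6 * t) := by
    have he : Real.exp 1 ^ 2 ≤ 9 := by
      nlinarith [Real.exp_one_lt_three, Real.exp_pos 1]
    have h4 : (4 : ℝ) ≤ 4 ^ t := le_self_pow₀ (by norm_num) (by omega)
    rw [Real.exp_neg, inv_mul_eq_div, le_div_iff₀ (Real.exp_pos _)]
    calc 4 * Real.exp t * Real.exp t = 4 * (Real.exp 1 ^ 2) ^ t := by
          rw [← pow_mul, mul_comm 2 t, pow_mul, ← Real.exp_nat_mul, mul_one]; ring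
      _ ≤ 4 ^ t * 9 ^ t := by gcongr
      _ = 36 ^ t := by rw [← mul_pow]; norm_num
      _ ≤ 64 ^ t := by gcongr; norm_num
      _ = 2 ^ (6 * t) := by rw [pow_mul]; norm_num
  rw [card_regChoices, Nat.cast_pow, ← hNdef, div_le_iff₀ (by positivity)]
  refine le_of_mul_le_mul_right (hP.trans ?_) (show (0 : ℝ) < 2 ^ (6 * t) by positivity)
  calc N ^ n * (4 * t ^ 4 * Real.exp t) = N ^ n * t ^ 4 * (4 * Real.exp t) := by ring
    _ ≤ N ^ n * t ^ 4 * (Real.exp (-(t : ℝ)) * 2 ^ (6 * t)) := by gcongr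
    _ = _ := by ring
end

section
/- There exists m₀ with the following property. Let m ≥ m₀ and 4 ≤ t ≤ m − 4, and let (X, Σ) be a set system with |Σ| = m in which every element x ∈ X belongs to exactly t sets of Σ (so its membership set T_x = {i : x ∈ S_i} is a t-element subset of {1, …, m}). Suppose that every t-element subset T ⊆ {1, …, m} satisfies |{x ∈ X : T_x = T}| ≥ 7. Then disc(Σ) ≤ 2. -/
open Finset

/-- A finite set can be two-colored with any prescribed sum of the right size and parity. -/
lemma exists_signs_sum_eq {α : Type*} [DecidableEq α] (F : Finset α) (z : ℤ)
    (hz : |z| ≤ (F.card : ℤ)) (hpar : (2 : ℤ) ∣ F.card - z) :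
    ∃ χ : α → ℤ, (∀ x, χ x = 1 ∨ χ x = -1) ∧ ∑ x ∈ F, χ x = z := by
  obtain ⟨k, hk⟩ := hpar
  rw [abs_le] at hz
  obtain ⟨G, hGF, hG⟩ := Finset.exists_subset_card_eq (s := F) (n := k.toNat) (by omega)
  refine ⟨fun x => if x ∈ G then -1 else 1, fun x => by dsimp only; split_ifs <;> simp, ?_⟩
  have h : ∀ x, (if x ∈ G then (-1 : ℤ) else 1) = 1 - 2 * (if x ∈ G then 1 else 0) := by
    intro x; split_ifs <;> norm_num
  simp only [h, Finset.sum_sub_distrib, ← Finset.mul_sum, Finset.sum_ite_mem,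
    Finset.inter_eq_right.2 hGF]
  simp only [Finset.sum_const, nsmul_eq_mul, mul_one, hG]
  omega

/-- A finite family of even size, whose members pairwise differ by vectors of squared norm at most
`K`, has a balanced signing whose signed sum has squared norm at most `K / 2` per member. -/
lemma exists_balanced_signs_of_even {β ι : Type*} [DecidableEq β] [Fintype ι] (x : β → ι → ℤ)
    (K : ℤ) (k : ℕ) : ∀ O : Finset β, O.card = 2 * k →
    (∀ a ∈ O, ∀ b ∈ O, ∑ i, (x a i - x b i) ^ 2 ≤ K) →
    ∃ ε : β → ℤ, (∀ a, ε a = 1 ∨ ε a = -1) ∧ ∑ a ∈ O, ε a = 0 ∧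
      ∑ i, (∑ a ∈ O, ε a * x a i) ^ 2 ≤ k * K := by
  induction k with
  | zero =>
    intro O hO _
    obtain rfl : O = ∅ := by simpa using hO
    exact ⟨fun _ => 1, by simp, by simp, by simp⟩
  | succ k ih =>
    intro O hO hK
    obtain ⟨a, O₁, ha, rfl, hO₁⟩ := Finset.card_eq_succ.1 (show O.card = (2 * k + 1) + 1 by omega)
    obtain ⟨b, O₂, hb, rfl, hO₂⟩ := Finset.card_eq_succ.1 hO₁
    obtain ⟨ε, hε, hsum, hsq⟩ := ih O₂ hO₂ fun c hc d hd => hK c (by simp [hc]) d (by simp [hd])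
    have hab : a ≠ b := by rintro rfl; simp at ha
    have haO : a ∉ O₂ := fun h => ha (by simp [h])
    obtain ⟨σ, hσ, hinner⟩ : ∃ σ : ℤ, (σ = 1 ∨ σ = -1) ∧
        σ * ∑ i, (∑ c ∈ O₂, ε c * x c i) * (x a i - x b i) ≤ 0 := by
      rcases le_total (∑ i, (∑ c ∈ O₂, ε c * x c i) * (x a i - x b i)) 0 with h | h
      · exact ⟨1, by simp, by linarith⟩
      · exact ⟨-1, by simp, by linarith⟩
    have hσ2 : σ ^ 2 = 1 := by rcases hσ with rfl | rfl <;> norm_num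
    have hagree : ∀ c ∈ O₂, (if c = a then σ else if c = b then -σ else ε c) = ε c := by
      intro c hc
      rw [if_neg (by rintro rfl; exact haO hc), if_neg (by rintro rfl; exact hb hc)]
    refine ⟨fun c => if c = a then σ else if c = b then -σ else ε c, ?_, ?_, ?_⟩
    · intro c
      dsimp only
      have := hε c
      split_ifs <;> omega
    · rw [Finset.sum_insert ha, Finset.sum_insert hb, Finset.sum_congr rfl hagree, hsum]
      simp [hab.symm]
    · have hvec : ∀ i, ∑ c ∈ insert a (insert b O₂),
          (if c = a then σ else if c = b then -σ else ε c) * x c i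
          = ∑ c ∈ O₂, ε c * x c i + σ * (x a i - x b i) := by
        intro i
        rw [Finset.sum_insert ha, Finset.sum_insert hb,
          Finset.sum_congr rfl fun c hc => by rw [hagree c hc]]
        simp only [if_true, if_neg hab.symm]
        ring
      have hexp : ∀ i, (∑ c ∈ O₂, ε c * x c i + σ * (x a i - x b i)) ^ 2
          = (∑ c ∈ O₂, ε c * x c i) ^ 2
            + 2 * (σ * ((∑ c ∈ O₂, ε c * x c i) * (x a i - x b i))) + (x a i - x b i) ^ 2 := by
        intro i
        linear_combination (x a i - x b i) ^ 2 * hσ2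
      simp only [hvec, hexp, Finset.sum_add_distrib, ← Finset.mul_sum]
      have := hK a (by simp) b (by simp)
      push_cast
      linarith

/-- A finite family of vectors with entries of size at most `1` has a signing which, up to a vector
with entries of size at most `1`, is as in `exists_balanced_signs_of_even`. -/
lemma exists_nearly_balanced_signs {β ι : Type*} [DecidableEq β] [Fintype ι] (x : β → ι → ℤ)
    (K : ℤ) (hK0 : 0 ≤ K) (O : Finset β) (hx : ∀ a i, |x a i| ≤ 1)
    (hK : ∀ a ∈ O, ∀ b ∈ O, ∑ i, (x a i - x b i) ^ 2 ≤ K) :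
    ∃ (ε : β → ℤ) (v : ι → ℤ), (∀ a, ε a = 1 ∨ ε a = -1) ∧ |∑ a ∈ O, ε a| ≤ 1 ∧
      (∀ i, |∑ a ∈ O, ε a * x a i - v i| ≤ 1) ∧ 2 * ∑ i, v i ^ 2 ≤ O.card * K := by
  rcases Nat.even_or_odd' O.card with ⟨k, hk | hk⟩
  · obtain ⟨ε, hε, hsum, hsq⟩ := exists_balanced_signs_of_even x K k O hk hK
    refine ⟨ε, fun i => ∑ a ∈ O, ε a * x a i, hε, by simp [hsum], by simp, ?_⟩
    rw [hk]
    push_cast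
    linarith
  · obtain ⟨a, O₁, ha, rfl, hO₁⟩ := Finset.card_eq_succ.1 hk
    obtain ⟨ε, hε, hsum, hsq⟩ := exists_balanced_signs_of_even x K k O₁ hO₁
      fun c hc d hd => hK c (by simp [hc]) d (by simp [hd])
    have habs : |ε a| = 1 := by rcases hε a with h | h <;> simp [h]
    refine ⟨ε, fun i => ∑ c ∈ O₁, ε c * x c i, hε, ?_, fun i => ?_, ?_⟩
    · rw [Finset.sum_insert ha, hsum, add_zero, habs]
    · rw [Finset.sum_insert ha, add_sub_cancel_right, abs_mul, habs, one_mul]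
      exact hx a i
    · rw [hk]
      push_cast
      linarith

/-- Entries in `[-2, 2]` with prescribed parities can be given any total of the right parity whose
size is at most the number of entries. -/
lemma exists_small_of_parity {ι : Type*} [DecidableEq ι] (v : ι → ℤ) (F : Finset ι) :
    ∀ s : ℤ, |s| ≤ (F.card : ℤ) → (2 : ℤ) ∣ ∑ i ∈ F, v i - s →
    ∃ u : ι → ℤ, (∀ i ∈ F, |u i| ≤ 2) ∧ (∀ i ∈ F, (2 : ℤ) ∣ u i - v i) ∧ ∑ i ∈ F, u i = s := by
  induction F using Finset.induction_on with
  | empty =>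
    intro s hs _
    exact ⟨v, by simp, by simp, by simpa [eq_comm] using hs⟩
  | insert a F ha ih =>
    intro s hs hpar
    rw [Finset.card_insert_of_notMem ha] at hs
    rw [Finset.sum_insert ha] at hpar
    have hempty : F.card = 0 → ∑ i ∈ F, v i = 0 := fun h => by
      rw [Finset.card_eq_zero.1 h, Finset.sum_empty]
    obtain ⟨c, hc2, hcpar, hcs⟩ : ∃ c : ℤ, |c| ≤ 2 ∧ (2 : ℤ) ∣ c - v a ∧ |s - c| ≤ F.card := by
      simp only [abs_le] at hs ⊢
      push_cast at hs
      rcases Int.emod_two_eq_zero_or_one (v a) with h | h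
      · by_cases h1 : s = F.card + 1
        · exact ⟨2, by omega, by omega, by omega⟩
        by_cases h2 : s = -(F.card + 1)
        · exact ⟨-2, by omega, by omega, by omega⟩
        exact ⟨0, by omega, by omega, by omega⟩
      · by_cases h1 : 0 < s
        · exact ⟨1, by omega, by omega, by omega⟩
        · exact ⟨-1, by omega, by omega, by omega⟩
    obtain ⟨u, hu2, hupar, hus⟩ := ih (s - c) hcs (by omega)
    have hne : ∀ i ∈ F, i ≠ a := fun i hi h => ha (h ▸ hi)
    refine ⟨Function.update u a c, ?_, ?_, ?_⟩
    · intro i hi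
      rcases Finset.mem_insert.1 hi with rfl | hi
      · simpa using hc2
      · simpa [hne i hi] using hu2 i hi
    · intro i hi
      rcases Finset.mem_insert.1 hi with rfl | hi
      · simpa using hcpar
      · simpa [hne i hi] using hupar i hi
    · rw [Finset.sum_insert ha, Finset.sum_update_of_notMem ha, hus]
      simp

/-- The `0/1` indicator vector of `T`. -/
def indVec {m : ℕ} (T : Finset (Fin m)) (i : Fin m) : ℤ := if i ∈ T then 1 else 0

lemma sum_indVec {m : ℕ} (T : Finset (Fin m)) : ∑ i, indVec T i = T.card := by
  simp [indVec]

lemma sum_indVec_sub_sq_le {m t : ℕ} {T T' : Finset (Fin m)} (hT : T.card = t)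
    (hT' : T'.card = t) :
    ∑ i, (indVec T i - indVec T' i) ^ 2 ≤ 2 * min (t : ℤ) (m - t) := by
  have h1 : ∑ i, (indVec T i - indVec T' i) ^ 2 ≤ ∑ i, (indVec T i + indVec T' i) :=
    Finset.sum_le_sum fun i _ => by unfold indVec; split_ifs <;> norm_num
  have h2 : ∑ i, (indVec T i - indVec T' i) ^ 2 ≤ ∑ i, (2 - (indVec T i + indVec T' i)) :=
    Finset.sum_le_sum fun i _ => by unfold indVec; split_ifs <;> norm_num
  simp only [Finset.sum_sub_distrib, Finset.sum_add_distrib, sum_indVec, hT, hT', Finset.sum_const,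
    Finset.card_univ, Fintype.card_fin, nsmul_eq_mul] at h1 h2
  rcases min_cases (t : ℤ) (m - t) with h | h <;> rw [h.1] <;> linarith

/-- An integer vector of total `0` and `ℓ¹`-norm at most `2 * (m - 2).choose (t - 1)` is a
combination of indicator vectors of `t`-sets with all coefficients in `[-3, 3]`. -/
lemma exists_bounded_combination {m t : ℕ} (ht : 1 ≤ t) (k : ℕ) :
    ∀ d : Fin m → ℤ, ∑ i, d i = 0 → ∑ i, |d i| ≤ k →
    ∑ i, |d i| ≤ 2 * ((m - 2).choose (t - 1) : ℕ) →
    ∃ w : Finset (Fin m) → ℤ, (∀ T, |w T| ≤ 3) ∧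
      ∑ T ∈ powersetCard t univ, |w T| ≤ ∑ i, |d i| ∧
      ∀ i, ∑ T ∈ powersetCard t univ, w T * indVec T i = d i := by
  induction k with
  | zero =>
    intro d _ hd _
    have h0 : ∀ i, d i = 0 := by
      intro i
      have := Finset.single_le_sum (f := fun i => |d i|) (fun i _ => abs_nonneg _)
        (Finset.mem_univ i)
      exact abs_nonpos_iff.1 (this.trans (by simpa using hd))
    exact ⟨fun _ => 0, by simp, by simp [h0], by simp [h0]⟩
  | succ k ih =>
    intro d hd0 hd hN
    by_cases hzero : ∀ i, d i = 0
    · exact ⟨fun _ => 0, by simp, by simp [hzero], by simp [hzero]⟩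
    obtain ⟨i, hi⟩ : ∃ i, 0 < d i := by
      by_contra! h
      exact hzero fun j => (Finset.sum_eq_zero_iff_of_nonpos fun j _ => h j).1 hd0 j (mem_univ j)
    obtain ⟨j, hj⟩ : ∃ j, d j < 0 := by
      by_contra! h
      exact hzero fun j => (Finset.sum_eq_zero_iff_of_nonneg fun j _ => h j).1 hd0 j (mem_univ j)
    have hij : i ≠ j := by rintro rfl; omega
    have hnorm : ∑ l, |d l - (if l = i then 1 else 0) + (if l = j then 1 else 0)|
        = ∑ l, |d l| - 2 := by
      have hl : ∀ l, |d l - (if l = i then 1 else 0) + (if l = j then 1 else 0)|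
          = |d l| - (if l = i then 1 else 0) - (if l = j then 1 else 0) := by
        intro l
        by_cases h1 : l = i
        · subst h1
          simp only [if_true, if_neg hij]
          rw [abs_of_pos hi, abs_of_nonneg (by omega)]; ring
        by_cases h2 : l = j
        · subst h2
          simp only [if_true, if_neg h1]
          rw [abs_of_neg hj, abs_of_nonpos (by omega)]; ring
        simp [h1, h2]
      simp only [hl, Finset.sum_sub_distrib, Finset.sum_ite_eq', Finset.mem_univ, if_true]
      ring
    obtain ⟨w, hw3, hwsum, hw⟩ := ih (fun l => d l - (if l = i then 1 else 0)
      + (if l = j then 1 else 0)) (by simp [Finset.sum_add_distrib, hd0])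
      (by rw [hnorm]; push_cast at hd; linarith) (by rw [hnorm]; linarith)
    rw [hnorm] at hwsum
    set P : Finset (Finset (Fin m)) := powersetCard (t - 1) (univ \ {i, j}) with hP
    have hPcard : P.card = (m - 2).choose (t - 1) := by
      rw [hP, card_powersetCard, card_sdiff_of_subset (subset_univ _), card_pair hij]
      simp
    have hPi : ∀ A ∈ P, i ∉ A ∧ j ∉ A ∧ A.card = t - 1 := by
      intro A hA
      rw [hP, mem_powersetCard] at hA
      refine ⟨fun h => ?_, fun h => ?_, hA.2⟩ <;> simpa using hA.1 h
    have hmem : ∀ A ∈ P, insert i A ∈ powersetCard t (univ : Finset (Fin m)) ∧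
        insert j A ∈ powersetCard t (univ : Finset (Fin m)) := by
      intro A hA
      obtain ⟨h1, h2, h3⟩ := hPi A hA
      simp only [mem_powersetCard, subset_univ, true_and, card_insert_of_notMem h1,
        card_insert_of_notMem h2]
      omega
    obtain ⟨A, hA, hAi, hAj⟩ : ∃ A ∈ P, |w (insert i A)| ≤ 2 ∧ |w (insert j A)| ≤ 2 := by
      by_contra! hblocked
      have h3 : ∑ A ∈ P, (3 : ℤ) ≤ ∑ A ∈ P, (|w (insert i A)| + |w (insert j A)|) := by
        refine Finset.sum_le_sum fun A hA => ?_
        have := hblocked A hA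
        have := abs_nonneg (w (insert i A))
        have := abs_nonneg (w (insert j A))
        by_contra! h
        have := hblocked A hA (by omega)
        omega
      have hinj : ∀ l, (∀ A ∈ P, l ∉ A) → ∀ A ∈ P, ∀ B ∈ P, insert l A = insert l B → A = B := by
        intro l hl A hA B hB h
        rw [← erase_insert (hl A hA), h, erase_insert (hl B hB)]
      have hdisj : Disjoint (P.image (insert i)) (P.image (insert j)) := by
        rw [Finset.disjoint_left]
        intro T hT hT'
        obtain ⟨A, hA, rfl⟩ := mem_image.1 hT
        obtain ⟨B, hB, h⟩ := mem_image.1 hT'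
        have : i ∈ insert j B := h ▸ mem_insert_self i A
        rcases mem_insert.1 this with h | h
        · exact hij h
        · exact (hPi B hB).1 h
      have hle : ∑ T ∈ P.image (insert i) ∪ P.image (insert j), |w T|
          ≤ ∑ T ∈ powersetCard t univ, |w T| := by
        refine Finset.sum_le_sum_of_subset_of_nonneg ?_ fun _ _ _ => abs_nonneg _
        intro T hT
        rcases mem_union.1 hT with h | h <;> obtain ⟨A, hA, rfl⟩ := mem_image.1 h
        exacts [(hmem A hA).1, (hmem A hA).2]
      rw [Finset.sum_union hdisj, Finset.sum_image (hinj i fun A hA => (hPi A hA).1),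
        Finset.sum_image (hinj j fun A hA => (hPi A hA).2.1), ← Finset.sum_add_distrib] at hle
      rw [Finset.sum_const, nsmul_eq_mul, hPcard] at h3
      linarith
    have hne : insert i A ≠ insert j A := by
      intro h
      have : i ∈ insert j A := h ▸ mem_insert_self i A
      rcases mem_insert.1 this with h | h
      · exact hij h
      · exact (hPi A hA).1 h
    refine ⟨fun T => w T + (if T = insert i A then 1 else 0) - (if T = insert j A then 1 else 0),
      fun T => ?_, ?_, fun l => ?_⟩
    · dsimp only
      by_cases h1 : T = insert i A
      · rw [if_pos h1, if_neg (h1 ▸ hne), h1]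
        rw [abs_le] at hAi ⊢
        omega
      by_cases h2 : T = insert j A
      · rw [if_neg h1, if_pos h2, h2]
        rw [abs_le] at hAj ⊢
        omega
      simpa [h1, h2] using hw3 T
    · have hl : ∀ T, |w T + (if T = insert i A then 1 else 0) - (if T = insert j A then 1 else 0)|
          ≤ |w T| + (if T = insert i A then 1 else 0) + (if T = insert j A then 1 else 0) := by
        intro T
        refine (abs_sub _ _).trans (add_le_add ((abs_add_le _ _).trans (add_le_add le_rfl ?_)) ?_)
          <;> split_ifs <;> simp
      refine (Finset.sum_le_sum fun T _ => hl T).trans ?_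
      simp only [Finset.sum_add_distrib, Finset.sum_ite_eq', (hmem A hA).1, (hmem A hA).2, if_true]
      linarith
    · have hv : indVec (insert i A) l - indVec (insert j A) l
          = (if l = i then 1 else 0) - (if l = j then 1 else 0) := by
        obtain ⟨h1, h2, -⟩ := hPi A hA
        simp only [indVec, mem_insert]
        by_cases hli : l = i
        · subst hli; simp [hij, h1]
        by_cases hlj : l = j
        · subst hlj; simp [hli, h2]
        simp [hli, hlj]
      simp only [add_mul, sub_mul, ite_mul, one_mul, zero_mul, Finset.sum_sub_distrib,
        Finset.sum_add_distrib, Finset.sum_ite_eq', (hmem A hA).1, (hmem A hA).2, if_true, hw l]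
      linarith

lemma choose_three_le_choose {n k : ℕ} (hk : 3 ≤ k) (hkn : k + 3 ≤ n) :
    n.choose 3 ≤ n.choose k := by
  have hhalf : ∀ r, 3 ≤ r → r ≤ n / 2 → n.choose 3 ≤ n.choose r := by
    intro r hr
    induction r, hr using Nat.le_induction with
    | base => intro _; exact le_rfl
    | succ r hr ih =>
      intro h
      exact (ih (by omega)).trans (Nat.choose_le_succ_of_lt_half_left (by omega))
  by_cases h : k ≤ n / 2
  · exact hhalf k hk h
  · rw [← Nat.choose_symm (show k ≤ n by omega)]
    exact hhalf (n - k) (by omega) (by omega)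

lemma sq_le_choose {m t : ℕ} (hm : 30 ≤ m) (ht : 4 ≤ t) (htm : t + 4 ≤ m) :
    m ^ 2 ≤ (m - 2).choose (t - 1) := by
  refine le_trans ?_ (choose_three_le_choose (by omega) (by omega))
  obtain ⟨n, rfl⟩ : ∃ n, m = n + 5 := ⟨m - 5, by omega⟩
  have h := Nat.descFactorial_eq_factorial_mul_choose (n + 3) 3
  simp only [Nat.descFactorial, Nat.factorial, Nat.succ_eq_add_one, Nat.sub_zero] at h
  rw [show n + 5 - 2 = n + 3 by omega]
  rw [show n + 3 - 2 = n + 1 by omega, show n + 3 - 1 = n + 2 by omega] at h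
  have hn : 25 ≤ n := by omega
  have h2 : 25 * (n * n) ≤ n * (n * n) := Nat.mul_le_mul_right _ hn
  have h3 : 25 * n ≤ n * n := Nat.mul_le_mul_right _ hn
  nlinarith

lemma choose_mul_mul_eq {m t : ℕ} (ht : 1 ≤ t) (htm : t + 1 ≤ m) :
    (m.choose t : ℤ) * (t * (m - t)) = m * (m - 1) * ((m - 2).choose (t - 1) : ℕ) := by
  obtain ⟨s, rfl⟩ : ∃ s, t = s + 1 := ⟨t - 1, by omega⟩
  obtain ⟨n, rfl⟩ : ∃ n, m = n + s + 2 := ⟨m - s - 2, by omega⟩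
  have h1 := Nat.add_one_mul_choose_eq (n + s + 1) s
  have h2 := Nat.choose_mul_succ_eq (n + s) s
  rw [show n + s + 1 - s = n + 1 by omega] at h2
  rw [show n + s + 1 + 1 = n + s + 2 by omega] at h1
  simp only [Nat.add_sub_cancel]
  zify at h1 h2
  push_cast
  linear_combination (-(n + 1) : ℤ) * h1 - (n + s + 2 : ℤ) * h2

/-- The integer form of the statement: every parity pattern `p` on the `t`-subsets of `Fin m` is
realized by integers in `[-7, 7]` whose sums over the stars are at most `2` in size. -/
lemma exists_weights {m t : ℕ} (hm : 30 ≤ m) (ht : 4 ≤ t) (htm : t + 4 ≤ m)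
    (p : Finset (Fin m) → ℕ) :
    ∃ z : Finset (Fin m) → ℤ, (∀ T, |z T| ≤ 7) ∧ (∀ T, (2 : ℤ) ∣ p T - z T) ∧
      ∀ i, |∑ T ∈ powersetCard t univ, z T * indVec T i| ≤ 2 := by
  set Ω : Finset (Finset (Fin m)) := powersetCard t univ with hΩ
  have hΩt : ∀ T ∈ Ω, T.card = t := fun T hT => (mem_powersetCard.1 hT).2
  set O := Ω.filter fun T => p T % 2 = 1 with hO
  set N : ℤ := ((m - 2).choose (t - 1) : ℤ) with hN
  set K : ℤ := 2 * min (t : ℤ) (m - t) with hK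
  have hK0 : 0 ≤ K := by omega
  obtain ⟨ε, v, hε, hεsum, hεv, hv⟩ := exists_nearly_balanced_signs indVec K hK0 O
    (fun T i => by unfold indVec; split_ifs <;> simp)
    fun T hT T' hT' => sum_indVec_sub_sq_le (hΩt T (mem_filter.1 hT).1)
      (hΩt T' (mem_filter.1 hT').1)
  set y : Fin m → ℤ := fun i => ∑ T ∈ O, ε T * indVec T i with hy
  have hmN : (m : ℤ) ^ 2 ≤ N := by rw [hN]; exact_mod_cast sq_le_choose hm ht htm
  have hN0 : 0 ≤ N := by positivity
  have hm' : (30 : ℤ) ≤ m := by exact_mod_cast hm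
  have hvsq : ∑ i, v i ^ 2 ≤ 2 * m * N := by
    have hOcard : (O.card : ℤ) ≤ m.choose t := by
      have := card_filter_le Ω fun T => p T % 2 = 1
      rw [hΩ, card_powersetCard, card_univ, Fintype.card_fin] at this
      exact_mod_cast this
    have hKm : K * m ≤ 4 * (t * (m - t)) := by
      have h1 : (0 : ℤ) ≤ t := by positivity
      have h2 : (t : ℤ) + 4 ≤ m := by exact_mod_cast htm
      rcases min_cases (t : ℤ) (m - t) with h | h <;> rw [hK, h.1] <;> nlinarith
    have hchoose := choose_mul_mul_eq (m := m) (t := t) (by omega) (by omega)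
    have h1 : (2 * ∑ i, v i ^ 2) * m ≤ (4 * m * N) * m := by
      calc (2 * ∑ i, v i ^ 2) * m ≤ (O.card * K) * m := by gcongr
        _ ≤ (m.choose t * K) * m := by gcongr
        _ = m.choose t * (K * m) := by ring
        _ ≤ m.choose t * (4 * (t * (m - t))) := by gcongr
        _ = 4 * (m * (m - 1) * N) := by rw [← hchoose]; ring
        _ ≤ (4 * m * N) * m := by nlinarith [mul_nonneg (by positivity : (0 : ℤ) ≤ m) hN0]
    have := le_of_mul_le_mul_right h1 (by linarith)
    linarith
  have hvabs : 2 * ∑ i, |v i| ≤ 2 * N + m ^ 2 := by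
    have h1 : ∑ i, 2 * m * |v i| ≤ ∑ i, (v i ^ 2 + (m : ℤ) ^ 2) :=
      Finset.sum_le_sum fun i _ => by
        rw [← sq_abs (v i)]
        nlinarith [sq_nonneg (|v i| - m)]
    rw [← Finset.mul_sum, Finset.sum_add_distrib, Finset.sum_const, Finset.card_univ,
      Fintype.card_fin, nsmul_eq_mul] at h1
    refine le_of_mul_le_mul_left (a := (m : ℤ)) ?_ (by linarith)
    linarith
  have hysum : ∑ i, y i = t * ∑ T ∈ O, ε T := by
    rw [hy, Finset.sum_comm, Finset.mul_sum]
    refine Finset.sum_congr rfl fun T hT => ?_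
    rw [← Finset.mul_sum, sum_indVec, hΩt T (mem_filter.1 hT).1, mul_comm]
  obtain ⟨u, hu2, hupar, husum⟩ := exists_small_of_parity y univ (∑ i, y i) (by
    rw [hysum, abs_mul, card_univ, Fintype.card_fin, Nat.abs_cast]
    have h1 : (t : ℤ) + 4 ≤ m := by exact_mod_cast htm
    nlinarith [abs_nonneg (∑ T ∈ O, ε T)]) (by simp)
  choose d hd using fun i => hupar i (mem_univ i)
  have hdsum : ∑ i, d i = 0 := by
    have : ∑ i, (u i - y i) = ∑ i, 2 * d i := Finset.sum_congr rfl fun i _ => hd i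
    rw [Finset.sum_sub_distrib, husum, ← Finset.mul_sum] at this
    linarith
  have hdabs : ∑ i, |d i| ≤ 2 * N := by
    have h1 : ∑ i, 2 * |d i| ≤ ∑ i, (3 + |v i|) := Finset.sum_le_sum fun i _ => by
      have h2 := hu2 i (mem_univ i)
      have h3 := hεv i
      have h4 := hd i
      change |y i - v i| ≤ 1 at h3
      rcases abs_cases (d i) with h | h <;> rcases abs_cases (v i) with h' | h' <;>
        rw [abs_le] at h2 h3 <;> omega
    rw [← Finset.mul_sum, Finset.sum_add_distrib, Finset.sum_const, Finset.card_univ,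
      Fintype.card_fin, nsmul_eq_mul] at h1
    nlinarith
  obtain ⟨w, hw3, -, hw⟩ := exists_bounded_combination (m := m) (t := t) (by omega)
    (∑ i, |d i|).toNat d hdsum (Int.self_le_toNat _) hdabs
  refine ⟨fun T => (if p T % 2 = 1 then ε T else 0) + 2 * w T, fun T => ?_, fun T => ?_,
    fun i => ?_⟩
  · have := abs_le.1 (hw3 T)
    rw [abs_le]
    rcases hε T with h | h <;> dsimp only <;> split_ifs <;> omega
  · rcases hε T with h | h <;> dsimp only <;> split_ifs <;> omega
  · have h1 : ∑ T ∈ Ω, (if p T % 2 = 1 then ε T else 0) * indVec T i = y i := by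
      simp only [hy, hO, Finset.sum_filter]
      exact Finset.sum_congr rfl fun T _ => by split_ifs <;> simp
    simp only [add_mul, mul_assoc, Finset.sum_add_distrib, ← Finset.mul_sum, h1]
    rw [hw i, ← hd i, add_sub_cancel]
    exact hu2 i (mem_univ i)

/-- For `m` large enough and `4 ≤ t ≤ m - 4`: if every element lies in exactly `t`
sets and every `t`-element subset `T ⊆ [m]` occurs as a membership set with
multiplicity at least `7`, then `disc(Σ) ≤ 2`. -/
theorem disc_le_two_of_multiplicity_ge_seven :
    ∃ m₀ : ℕ, ∀ m t n : ℕ, m₀ ≤ m → 4 ≤ t → t + 4 ≤ m →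
      ∀ S : Fin m → Finset (Fin n),
        (∀ x : Fin n, (Finset.univ.filter fun i : Fin m => x ∈ S i).card = t) →
        (∀ T : Finset (Fin m), T.card = t →
          7 ≤ (Finset.univ.filter fun x : Fin n =>
                (Finset.univ.filter fun i : Fin m => x ∈ S i) = T).card) →
        disc S ≤ 2 := by
  refine ⟨30, fun m t n hm ht htm S hdeg hmult => Nat.sInf_le ?_⟩
  set τ : Fin n → Finset (Fin m) := fun x => univ.filter fun i => x ∈ S i with hτ
  obtain ⟨z, hz7, hzpar, hz⟩ := exists_weights hm ht htm
    fun T => (univ.filter fun x => τ x = T).card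
  have hfib : ∀ T : Finset (Fin m), ∃ χ : Fin n → ℤ, (∀ x, χ x = 1 ∨ χ x = -1) ∧
      (T.card = t → ∑ x ∈ univ.filter (fun x => τ x = T), χ x = z T) := by
    intro T
    by_cases hT : T.card = t
    · obtain ⟨χ, hχ, hsum⟩ := exists_signs_sum_eq (univ.filter fun x => τ x = T) (z T)
        ((hz7 T).trans (by exact_mod_cast hmult T hT)) (hzpar T)
      exact ⟨χ, hχ, fun _ => hsum⟩
    · exact ⟨fun _ => 1, by simp, fun h => absurd h hT⟩
  choose χ hχ hχsum using hfib
  refine ⟨fun x => χ (τ x) x, fun x => hχ _ x, fun i => ?_⟩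
  have hsum : ∑ x ∈ S i, χ (τ x) x = ∑ T ∈ powersetCard t univ, z T * indVec T i := by
    rw [← Finset.sum_fiberwise_of_maps_to (t := powersetCard t univ) (g := τ)
      fun x _ => mem_powersetCard.2 ⟨subset_univ _, hdeg x⟩]
    refine Finset.sum_congr rfl fun T hT => ?_
    have hmem : ∀ x, i ∈ τ x ↔ x ∈ S i := fun x => by simp [hτ]
    by_cases hi : i ∈ T
    · rw [indVec, if_pos hi, mul_one, ← hχsum T (mem_powersetCard.1 hT).2]
      refine Finset.sum_congr ?_ fun x hx => by rw [(mem_filter.1 hx).2]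
      ext x
      simp only [mem_filter, mem_univ, true_and, and_iff_right_iff_imp]
      rintro rfl
      exact (hmem x).1 hi
    · rw [indVec, if_neg hi, mul_zero]
      refine Finset.sum_eq_zero fun x hx => ?_
      obtain ⟨hxS, rfl⟩ := mem_filter.1 hx
      exact absurd ((hmem x).2 hxS) hi
  rw [hsum]
  have := hz i
  rw [Int.abs_eq_natAbs] at this
  exact_mod_cast this
end

section
/- Let 1 ≤ t ≤ m − 1. For every w ∈ ℤ^m with Σ_{i=1}^m w_i ≡ 0 (mod t), there exist integers a_S, indexed by the t-element subsets S of {1, …, m}, such that Σ_S a_S·1_S = w and |a_S| ≤ 2·‖w‖₁ / C(m−2, t−1) + 2 for every S. -/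
open Finset

/-- The quantity `‖r‖₁ + |Σ r|`, which decreases along the greedy decomposition. -/
def residualMass {V : Type*} [Fintype V] (r : V → ℤ) : ℤ :=
  ∑ i, |r i| + |∑ i, r i|

lemma residualMass_neg {V : Type*} [Fintype V] (r : V → ℤ) :
    residualMass (-r) = residualMass r := by
  simp [residualMass]

lemma abs_add_single_le {V : Type*} [DecidableEq V] {a : Finset V → ℤ} {B : ℤ}
    (ha : ∀ S, |a S| ≤ B) {T : Finset V} {c : ℤ} (hc : |c| ≤ 1) (hT : |a T| < B)
    (S : Finset V) : |(a + Pi.single T c : Finset V → ℤ) S| ≤ B := by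
  rcases eq_or_ne S T with rfl | h
  · have := abs_add_le (a S) c
    simp only [Pi.add_apply, Pi.single_eq_same]
    omega
  · simpa [h] using ha S

section BoundedDecomposition

variable {V : Type*} [Fintype V] [DecidableEq V]

/-- The vector `Σ_S a_S 1_S`. -/
def indicatorSum (a : Finset V → ℤ) (j : V) : ℤ :=
  ∑ S : Finset V, a S * (if j ∈ S then 1 else 0)

lemma indicatorSum_add (a b : Finset V → ℤ) (j : V) :
    indicatorSum (a + b) j = indicatorSum a j + indicatorSum b j := by
  simp only [indicatorSum, Pi.add_apply, add_mul, sum_add_distrib]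

lemma indicatorSum_neg (a : Finset V → ℤ) (j : V) :
    indicatorSum (-a) j = -indicatorSum a j := by
  simp only [indicatorSum, Pi.neg_apply, neg_mul, sum_neg_distrib]

lemma indicatorSum_single (S : Finset V) (j : V) :
    indicatorSum (Pi.single S 1) j = if j ∈ S then 1 else 0 := by
  simp only [indicatorSum, Pi.single_apply, ite_mul, one_mul, zero_mul, sum_ite_eq', mem_univ,
    if_true]

/-- If `a` has small `ℓ¹` norm, then for some `R` both `a (R ∪ {i})` and `a (R ∪ {j})` are small. -/
lemma exists_insert_lt {t : ℕ} (ht : 1 ≤ t) {i j : V} (hij : i ≠ j) {B : ℤ} (a : Finset V → ℤ)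
    (ha : ∑ S, |a S| < (Fintype.card V - 2).choose (t - 1) * B) :
    ∃ R : Finset V, i ∉ R ∧ j ∉ R ∧ (insert i R).card = t ∧ (insert j R).card = t ∧
      |a (insert i R)| < B ∧ |a (insert j R)| < B := by
  set P := powersetCard (t - 1) ((univ.erase i).erase j) with hP
  have hcard : P.card = (Fintype.card V - 2).choose (t - 1) := by
    rw [hP, card_powersetCard, card_erase_of_mem (by simp [hij.symm]),
      card_erase_of_mem (mem_univ i), card_univ, Nat.sub_sub]
  have hmem : ∀ R ∈ P, i ∉ R ∧ j ∉ R ∧ R.card = t - 1 := by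
    intro R hR
    rw [hP, mem_powersetCard] at hR
    exact ⟨fun h => by simpa using hR.1 h, fun h => by simpa using hR.1 h, hR.2⟩
  have hinj : ∀ k : V, (∀ R ∈ P, k ∉ R) → Set.InjOn (insert k) (P : Set (Finset V)) := by
    intro k hk R hR R' hR' h
    rw [← erase_insert (hk R hR), ← erase_insert (hk R' hR'), h]
  have hi : ∑ R ∈ P, |a (insert i R)| ≤ ∑ S with i ∈ S, |a S| := by
    rw [← sum_image (f := fun S => |a S|) (hinj i fun R hR => (hmem R hR).1)]
    refine sum_le_sum_of_subset_of_nonneg ?_ fun _ _ _ => abs_nonneg _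
    intro S hS
    obtain ⟨R, -, rfl⟩ := mem_image.1 hS
    simp
  have hj : ∑ R ∈ P, |a (insert j R)| ≤ ∑ S with i ∉ S, |a S| := by
    rw [← sum_image (f := fun S => |a S|) (hinj j fun R hR => (hmem R hR).2.1)]
    refine sum_le_sum_of_subset_of_nonneg ?_ fun _ _ _ => abs_nonneg _
    intro S hS
    obtain ⟨R, hR, rfl⟩ := mem_image.1 hS
    simp [hij, (hmem R hR).1]
  have hlt : ∑ R ∈ P, (|a (insert i R)| + |a (insert j R)|) < ∑ _R ∈ P, B := by
    rw [sum_add_distrib, sum_const, hcard, nsmul_eq_mul]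
    have := sum_filter_add_sum_filter_not univ (fun S : Finset V => i ∈ S) fun S => |a S|
    linarith
  obtain ⟨R, hR, hRB⟩ := exists_lt_of_sum_lt hlt
  obtain ⟨hiR, hjR, hRc⟩ := hmem R hR
  refine ⟨R, hiR, hjR, ?_, ?_, ?_, ?_⟩
  · rw [card_insert_of_notMem hiR]; omega
  · rw [card_insert_of_notMem hjR]; omega
  · linarith [abs_nonneg (a (insert j R))]
  · linarith [abs_nonneg (a (insert i R))]

lemma sum_abs_add_single_le (a : Finset V → ℤ) (T : Finset V) (c : ℤ) :
    ∑ S, |(a + Pi.single T c : Finset V → ℤ) S| ≤ ∑ S, |a S| + |c| := by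
  calc ∑ S, |(a + Pi.single T c : Finset V → ℤ) S| ≤ ∑ S, (|a S| + if S = T then |c| else 0) := by
        refine sum_le_sum fun S _ => ?_
        rcases eq_or_ne S T with rfl | h
        · simpa using abs_add_le (a S) c
        · simp [h]
    _ = _ := by simp [sum_add_distrib]

lemma sum_abs_sub_indicator_le (r : V → ℤ) {S : Finset V} {i : V} (hiS : i ∈ S) (hi : 0 < r i) :
    ∑ k, |r k - if k ∈ S then 1 else 0| ≤ ∑ k, |r k| + S.card - 2 := by
  calc ∑ k, |r k - if k ∈ S then 1 else 0|
      ≤ ∑ k, (|r k| + (if k ∈ S then 1 else 0) - if k = i then 2 else 0) := by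
        refine sum_le_sum fun k _ => ?_
        split_ifs <;> grind
    _ = _ := by simp [sum_add_distrib, sum_sub_distrib]

lemma sum_abs_swap (r : V → ℤ) {i j : V} (hi : 0 < r i) (hj : r j < 0) :
    ∑ k, |r k - (if k = i then 1 else 0) + if k = j then 1 else 0| = ∑ k, |r k| - 2 := by
  calc ∑ k, |r k - (if k = i then 1 else 0) + if k = j then 1 else 0|
      = ∑ k, (|r k| - (if k = i then 1 else 0) - if k = j then 1 else 0) := by
        refine sum_congr rfl fun k _ => ?_
        split_ifs <;> grind
    _ = _ := by simp [sum_sub_distrib]; ring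

/-- One greedy step, when the coordinate sum of the residual `r` is nonnegative. -/
lemma exists_greedy_step_of_nonneg {t : ℕ} (ht : 1 ≤ t) (hV : 2 ≤ Fintype.card V) {B : ℤ}
    {a : Finset V → ℤ} {r : V → ℤ} (hsupp : ∀ S, S.card ≠ t → a S = 0) (hB : ∀ S, |a S| ≤ B)
    (ha : ∑ S, |a S| < (Fintype.card V - 2).choose (t - 1) * B) (hr : (t : ℤ) ∣ ∑ i, r i)
    (hr₀ : r ≠ 0) (hsum : 0 ≤ ∑ i, r i) :
    ∃ (a' : Finset V → ℤ) (r' : V → ℤ), (∀ S, S.card ≠ t → a' S = 0) ∧ (∀ S, |a' S| ≤ B) ∧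
      (t : ℤ) ∣ ∑ i, r' i ∧ residualMass r' < residualMass r ∧
      ∑ S, |a' S| + residualMass r' ≤ ∑ S, |a S| + residualMass r ∧
      ∀ j, indicatorSum a' j + r' j = indicatorSum a j + r j := by
  have hpos : ∃ i, 0 < r i := by
    by_contra! h
    have h0 : ∑ i, r i = 0 := le_antisymm (sum_nonpos fun i _ => h i) hsum
    exact hr₀ (funext fun i =>
      (sum_eq_zero_iff_of_nonpos fun i _ => h i).1 h0 i (mem_univ i))
  obtain ⟨i, hi⟩ := hpos
  rcases hsum.eq_or_lt with h0 | hlt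
  · obtain ⟨j, hj⟩ : ∃ j, r j < 0 := by
      by_contra! h
      exact hi.ne' ((sum_eq_zero_iff_of_nonneg fun i _ => h i).1 h0.symm i (mem_univ i))
    have hij : i ≠ j := by rintro rfl; omega
    obtain ⟨R, hiR, hjR, hic, hjc, hia, hja⟩ := exists_insert_lt ht hij a ha
    have hne : insert j R ≠ insert i R := fun h => by
      have : i ∈ insert j R := h ▸ mem_insert_self i R
      simp [hij, hiR] at this
    have hsum' : ∑ k, (r k - (if k = i then 1 else 0) + if k = j then 1 else 0) = ∑ k, r k := by
      simp [sum_add_distrib, sum_sub_distrib]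
    have habs := sum_abs_swap r hi hj
    refine ⟨a + Pi.single (insert i R) 1 + Pi.single (insert j R) (-1),
      fun k => r k - (if k = i then 1 else 0) + if k = j then 1 else 0, ?_, ?_, ?_, ?_, ?_, ?_⟩
    · intro S hS
      have h1 : S ≠ insert i R := by rintro rfl; exact hS hic
      have h2 : S ≠ insert j R := by rintro rfl; exact hS hjc
      simp [hsupp S hS, h1, h2]
    · exact abs_add_single_le (abs_add_single_le hB (by simp) hia) (by simp) (by simpa [hne])
    · rwa [hsum']
    · simp only [residualMass, hsum', habs]; omega
    · have h1 := sum_abs_add_single_le a (insert i R) 1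
      have h2 := sum_abs_add_single_le (a + Pi.single (insert i R) 1) (insert j R) (-1)
      simp only [residualMass, hsum', habs]
      simp only [abs_neg, abs_one] at h1 h2
      omega
    · intro k
      rw [Pi.single_neg, indicatorSum_add, indicatorSum_add, indicatorSum_neg, indicatorSum_single,
        indicatorSum_single]
      by_cases hki : k = i
      · subst hki; simp [hiR, hij]
      · by_cases hkj : k = j
        · subst hkj; simp [hjR, hki]; ring
        · simp [hki, hkj]
  · have : Nontrivial V := Fintype.one_lt_card_iff_nontrivial.1 hV
    obtain ⟨j, hij⟩ := exists_ne i
    obtain ⟨R, -, -, hic, -, hia, -⟩ := exists_insert_lt ht hij.symm a ha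
    have hle := Int.le_of_dvd hlt hr
    have hsum' : ∑ k, (r k - if k ∈ insert i R then 1 else 0) = ∑ k, r k - t := by
      rw [sum_sub_distrib, ← hic]
      simp only [sum_boole, filter_univ_mem]
    have habs := sum_abs_sub_indicator_le r (mem_insert_self i R) hi
    rw [hic] at habs
    refine ⟨a + Pi.single (insert i R) 1, fun k => r k - if k ∈ insert i R then 1 else 0,
      ?_, ?_, ?_, ?_, ?_, ?_⟩
    · intro S hS
      have h1 : S ≠ insert i R := by rintro rfl; exact hS hic
      simp [hsupp S hS, h1]
    · exact abs_add_single_le hB (by simp) hia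
    · rw [hsum']; exact dvd_sub_self_right.2 hr
    · simp only [residualMass, hsum', abs_of_nonneg hsum, abs_of_nonneg (sub_nonneg.2 hle)]
      omega
    · have h1 := sum_abs_add_single_le a (insert i R) 1
      simp only [residualMass, hsum', abs_of_nonneg hsum, abs_of_nonneg (sub_nonneg.2 hle)]
      simp only [abs_one] at h1
      omega
    · intro k
      rw [indicatorSum_add, indicatorSum_single]
      ring

/-- One greedy step: adjust `a` so that the residual `r` gets smaller. -/
lemma exists_greedy_step {t : ℕ} (ht : 1 ≤ t) (hV : 2 ≤ Fintype.card V) {B : ℤ}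
    {a : Finset V → ℤ} {r : V → ℤ} (hsupp : ∀ S, S.card ≠ t → a S = 0) (hB : ∀ S, |a S| ≤ B)
    (ha : ∑ S, |a S| < (Fintype.card V - 2).choose (t - 1) * B) (hr : (t : ℤ) ∣ ∑ i, r i)
    (hr₀ : r ≠ 0) :
    ∃ (a' : Finset V → ℤ) (r' : V → ℤ), (∀ S, S.card ≠ t → a' S = 0) ∧ (∀ S, |a' S| ≤ B) ∧
      (t : ℤ) ∣ ∑ i, r' i ∧ residualMass r' < residualMass r ∧
      ∑ S, |a' S| + residualMass r' ≤ ∑ S, |a S| + residualMass r ∧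
      ∀ j, indicatorSum a' j + r' j = indicatorSum a j + r j := by
  rcases le_total 0 (∑ i, r i) with hsum | hsum
  · exact exists_greedy_step_of_nonneg ht hV hsupp hB ha hr hr₀ hsum
  · obtain ⟨a', r', h1, h2, h3, h4, h5, h6⟩ := exists_greedy_step_of_nonneg (a := -a) (r := -r)
      ht hV (by simpa using hsupp) (by simpa using hB) (by simpa using ha) (by simpa using hr)
      (by simpa using hr₀) (by simpa using hsum)
    refine ⟨-a', -r', by simpa using h1, by simpa using h2, by simpa using h3, ?_, ?_, ?_⟩
    · rwa [residualMass_neg] at h4 ⊢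
    · simpa [residualMass_neg] using h5
    · intro j
      have := h6 j
      rw [indicatorSum_neg] at this ⊢
      simp only [Pi.neg_apply] at this ⊢
      omega

/-- Iterating greedy steps until the residual vanishes. -/
lemma exists_bounded_indicatorSum {t : ℕ} (ht : 1 ≤ t) (hV : 2 ≤ Fintype.card V) {B : ℤ}
    (a : Finset V → ℤ) (r : V → ℤ) (hsupp : ∀ S, S.card ≠ t → a S = 0) (hB : ∀ S, |a S| ≤ B)
    (ha : ∑ S, |a S| + residualMass r < (Fintype.card V - 2).choose (t - 1) * B)
    (hr : (t : ℤ) ∣ ∑ i, r i) :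
    ∃ a' : Finset V → ℤ, (∀ S, S.card ≠ t → a' S = 0) ∧ (∀ S, |a' S| ≤ B) ∧
      ∀ j, indicatorSum a' j = indicatorSum a j + r j := by
  have hnonneg : ∀ r : V → ℤ, 0 ≤ residualMass r := fun r =>
    add_nonneg (sum_nonneg fun _ _ => abs_nonneg _) (abs_nonneg _)
  induction hn : (residualMass r).toNat using Nat.strong_induction_on generalizing a r with
  | _ n ih =>
    rcases eq_or_ne r 0 with rfl | hr₀
    · exact ⟨a, hsupp, hB, by simp⟩
    · obtain ⟨a', r', h1, h2, h3, h4, h5, h6⟩ := exists_greedy_step ht hV hsupp hB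
        (by linarith [hnonneg r]) hr hr₀
      obtain ⟨b, hb1, hb2, hb3⟩ := ih _ (by have := hnonneg r'; omega) a' r' h1 h2
        (by linarith) h3 rfl
      exact ⟨b, hb1, hb2, fun j => by rw [hb3, h6]⟩

end BoundedDecomposition

/-- Every `w ∈ ℤ^m` whose coordinate sum is divisible by `t` is an integer combination
`w = Σ_S a_S 1_S` of indicators of `t`-element subsets `S ⊆ [m]`, with all coefficients
bounded: `|a_S| ≤ 2‖w‖₁ / C(m-2, t-1) + 2`. -/
theorem lattice_decomposition (m t : ℕ) (ht : 1 ≤ t) (htm : t + 1 ≤ m)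
    (w : Fin m → ℤ) (hw : (t : ℤ) ∣ ∑ i, w i) :
    ∃ a : Finset (Fin m) → ℤ,
      (∀ S : Finset (Fin m), S.card ≠ t → a S = 0) ∧
      (∀ j : Fin m, ∑ S : Finset (Fin m), a S * (if j ∈ S then 1 else 0) = w j) ∧
      (∀ S : Finset (Fin m),
        (|a S| : ℝ) ≤ 2 * ((∑ i, |w i| : ℤ) : ℝ) / ((m - 2).choose (t - 1)) + 2) := by
  set N := (m - 2).choose (t - 1) with hN
  have hNpos : 0 < N := Nat.choose_pos (by omega)
  set K : ℤ := 2 * ∑ i, |w i| with hK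
  have hK0 : 0 ≤ K := mul_nonneg zero_le_two (sum_nonneg fun _ _ => abs_nonneg _)
  have hB0 : 0 ≤ K / N + 1 := by positivity
  have hmass : residualMass w ≤ K := by
    have := abs_sum_le_sum_abs w univ
    simp only [residualMass]
    omega
  obtain ⟨a, ha, haB, haw⟩ := exists_bounded_indicatorSum (B := K / N + 1) ht
    (by simp; omega) (0 : Finset (Fin m) → ℤ) w (by simp) (by simpa using hB0) (by
      rw [Fintype.card_fin, ← hN]
      have := Int.lt_mul_ediv_self_add (x := K) (k := N) (by exact_mod_cast hNpos)
      simp only [Pi.zero_apply, abs_zero, sum_const_zero]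
      linarith) hw
  refine ⟨a, ha, fun j => ?_, fun S => ?_⟩
  · simpa [indicatorSum] using haw j
  · have h1 : (|a S| : ℝ) ≤ ((K / N : ℤ) : ℝ) + 1 := by exact_mod_cast haB S
    have h2 : ((K / N : ℤ) : ℝ) ≤ (K : ℝ) / N := by
      rw [le_div_iff₀ (by exact_mod_cast hNpos)]
      exact_mod_cast Int.ediv_mul_le K (by exact_mod_cast hNpos.ne')
    have h3 : (K : ℝ) = 2 * ((∑ i, |w i| : ℤ) : ℝ) := by rw [hK]; push_cast; ring
    rw [h3] at h2
    linarith
end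

section
/- Let 1 ≤ t ≤ m − 1. For every w ∈ ℤ^m with Σ_{i=1}^m w_i = 0, there exist integers a_S, indexed by the t-element subsets S of {1, …, m}, such that Σ_S a_S·1_S = w and |a_S| ≤ ‖w‖₁ / C(m−2, t−1) + 1 for every S. -/
open Finset

/-- Markov's inequality for counting: the number of points `R ∈ B` with `K ≤ p (g R)`, times `K`,
is at most the total mass of `p`, when `g` is injective on `B`. -/
lemma card_filter_le_comp_mul_le_sum {α β : Type*} [Fintype β] (B : Finset α) (g : α → β)
    (hg : Set.InjOn g B) (p : β → ℕ) (K : ℕ) :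
    #{R ∈ B | K ≤ p (g R)} * K ≤ ∑ S, p S := by
  classical
  calc #{R ∈ B | K ≤ p (g R)} * K ≤ ∑ R ∈ B with K ≤ p (g R), p (g R) := by
        rw [← smul_eq_mul]
        exact card_nsmul_le_sum _ _ _ fun R hR => (mem_filter.1 hR).2
    _ = ∑ S ∈ image g {R ∈ B | K ≤ p (g R)}, p S :=
        (sum_image (hg.mono (coe_subset.2 (filter_subset _ _)))).symm
    _ ≤ ∑ S, p S := sum_le_sum_of_subset (subset_univ _)

lemma sum_add_single_mul_indicator {m : ℕ} (p : Finset (Fin m) → ℕ) (T : Finset (Fin m))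
    (k : Fin m) :
    ∑ S, (((p + Pi.single T 1 : Finset (Fin m) → ℕ) S : ℕ) : ℤ) * (if k ∈ S then 1 else 0) =
      ∑ S, (p S : ℤ) * (if k ∈ S then 1 else 0) + if k ∈ T then 1 else 0 := by
  simp only [Pi.add_apply, Nat.cast_add, add_mul, sum_add_distrib]
  congr 1
  rw [sum_eq_single T] <;> simp +contextual

lemma add_single_le {α : Type*} [DecidableEq α] {p : α → ℕ} {T : α} {K : ℕ}
    (hp : ∀ S, p S ≤ K) (hT : p T < K) (S : α) : (p + Pi.single T 1 : α → ℕ) S ≤ K := by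
  by_cases h : S = T
  · subst h; simpa using hT
  · simpa [h] using hp S

lemma add_single_eq_zero {m t : ℕ} {p : Finset (Fin m) → ℕ} {T : Finset (Fin m)}
    (hp : ∀ S, #S ≠ t → p S = 0) (hT : #T = t) (S : Finset (Fin m)) (hS : #S ≠ t) :
    (p + Pi.single T 1 : Finset (Fin m) → ℕ) S = 0 := by
  have h : S ≠ T := by rintro rfl; exact hS hT
  simp [h, hp S hS]

/-- If the total mass of `p` and `q` is less than `K * (m - 2).choose t`, then some `t`-set `R`
avoiding `i` and `j` has `p` below `K` at `insert i R` and `q` below `K` at `insert j R`. -/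
lemma exists_card_eq_insert_lt {m t K : ℕ} {i j : Fin m} (hij : i ≠ j)
    (p q : Finset (Fin m) → ℕ) (h : ∑ S, p S + ∑ S, q S < K * (m - 2).choose t) :
    ∃ R : Finset (Fin m), #R = t ∧ i ∉ R ∧ j ∉ R ∧ p (insert i R) < K ∧ q (insert j R) < K := by
  set B := powersetCard t (univ \ {i, j} : Finset (Fin m))
  have hB : #B = (m - 2).choose t := by
    simp [B, card_powersetCard, card_sdiff, card_pair hij]
  have hmem {R} (hR : R ∈ B) : i ∉ R ∧ j ∉ R ∧ #R = t := by
    obtain ⟨hs, hc⟩ := mem_powersetCard.1 hR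
    exact ⟨fun hi => by simpa using hs hi, fun hj => by simpa using hs hj, hc⟩
  have hinj (k : Fin m) (hk : ∀ R ∈ B, k ∉ R) :
      Set.InjOn (fun R : Finset (Fin m) => insert k R) B := by
    intro R hR R' hR' e
    simpa [erase_insert (hk R hR), erase_insert (hk R' hR')] using congrArg (erase · k) e
  have hp := card_filter_le_comp_mul_le_sum B (insert i) (hinj i fun R hR => (hmem hR).1) p K
  have hq := card_filter_le_comp_mul_le_sum B (insert j) (hinj j fun R hR => (hmem hR).2.1) q K
  by_contra! hno
  have hcover : B ⊆ {R ∈ B | K ≤ p (insert i R)} ∪ {R ∈ B | K ≤ q (insert j R)} := by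
    intro R hR
    obtain ⟨hi, hj, hc⟩ := hmem hR
    have := hno R hc hi hj
    simp only [mem_union, mem_filter, hR, true_and]
    by_cases hK : K ≤ p (insert i R)
    · exact Or.inl hK
    · exact Or.inr (this (not_le.1 hK))
  have hcard := (card_le_card hcover).trans (card_union_le _ _)
  rw [hB] at hcard
  nlinarith [Nat.mul_le_mul_left K hcard]

lemma exists_pos_and_neg_of_sum_zero {ι : Type*} [Fintype ι] {w : ι → ℤ} (hw : ∑ i, w i = 0)
    (hne : w ≠ 0) : ∃ i j, 0 < w i ∧ w j < 0 := by
  obtain ⟨k, hk⟩ := Function.ne_iff.1 hne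
  obtain ⟨i, -, hi⟩ := exists_pos_of_sum_zero_of_exists_nonzero w hw ⟨k, mem_univ k, hk⟩
  obtain ⟨j, -, hj⟩ := exists_pos_of_sum_zero_of_exists_nonzero (fun i => -w i)
    (by simp [hw]) ⟨k, mem_univ k, neg_ne_zero.2 hk⟩
  exact ⟨i, j, hi, neg_pos.1 hj⟩

lemma sum_abs_sub_single_add_single {ι : Type*} [Fintype ι] [DecidableEq ι] {w : ι → ℤ} {i j : ι}
    (hi : 0 < w i) (hj : w j < 0) :
    ∑ k, |(w - Pi.single i 1 + Pi.single j 1 : ι → ℤ) k| + 2 = ∑ k, |w k| := by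
  have hij : i ≠ j := by rintro rfl; omega
  have key (k : ι) : |(w - Pi.single i 1 + Pi.single j 1 : ι → ℤ) k| =
      |w k| - (Pi.single i 1 : ι → ℤ) k - (Pi.single j 1 : ι → ℤ) k := by
    by_cases h1 : k = i
    · subst h1
      simp only [Pi.add_apply, Pi.sub_apply, Pi.single_eq_same, Pi.single_eq_of_ne hij]
      rw [abs_of_pos hi, abs_of_nonneg (by omega)]
      ring
    · by_cases h2 : k = j
      · subst h2
        simp only [Pi.add_apply, Pi.sub_apply, Pi.single_eq_same, Pi.single_eq_of_ne h1]
        rw [abs_of_neg hj, abs_of_nonpos (by omega)]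
        ring
      · simp [h1, h2]
  simp only [key, sum_sub_distrib, sum_pi_single', mem_univ, if_true]
  ring

/-- Greedy decomposition of a sum-zero vector as a difference of two nonnegative combinations of
indicators of `(t + 1)`-sets with all coefficients at most `K`. -/
lemma exists_bounded_decomposition {m t K : ℕ} (n : ℕ) (w : Fin m → ℤ) (hw : ∑ i, w i = 0)
    (hn : ∑ i, |w i| ≤ n) (hK : ∑ i, |w i| < K * (m - 2).choose t) :
    ∃ p q : Finset (Fin m) → ℕ,
      (∀ S, #S ≠ t + 1 → p S = 0) ∧ (∀ S, #S ≠ t + 1 → q S = 0) ∧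
      (∀ S, p S ≤ K) ∧ (∀ S, q S ≤ K) ∧
      ((2 * ∑ S, p S : ℕ) : ℤ) ≤ ∑ i, |w i| ∧ ((2 * ∑ S, q S : ℕ) : ℤ) ≤ ∑ i, |w i| ∧
      ∀ k, ∑ S, (p S : ℤ) * (if k ∈ S then 1 else 0) -
        ∑ S, (q S : ℤ) * (if k ∈ S then 1 else 0) = w k := by
  induction n generalizing w with
  | zero =>
    have h0 : w = 0 := by
      funext k
      have := single_le_sum (f := fun i => |w i|) (fun i _ => abs_nonneg _) (mem_univ k)
      exact abs_nonpos_iff.1 (this.trans (by simpa using hn))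
    exact ⟨0, 0, by simp [h0]⟩
  | succ n ih =>
    by_cases h0 : w = 0
    · exact ⟨0, 0, by simp [h0]⟩
    obtain ⟨i, j, hi, hj⟩ := exists_pos_and_neg_of_sum_zero hw h0
    have hij : i ≠ j := by rintro rfl; omega
    have habs := sum_abs_sub_single_add_single hi hj
    obtain ⟨p, q, hp0, hq0, hpK, hqK, hps, hqs, heq⟩ :=
      ih (w - Pi.single i 1 + Pi.single j 1) (by simp [sum_add_distrib, hw])
        (by push_cast at hn; omega) (by omega)
    obtain ⟨R, hR, hiR, hjR, hpR, hqR⟩ := exists_card_eq_insert_lt (t := t) (K := K) hij p q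
      (by zify at *; linarith)
    refine ⟨p + Pi.single (insert i R) 1, q + Pi.single (insert j R) 1,
      add_single_eq_zero hp0 (by rw [card_insert_of_notMem hiR, hR]),
      add_single_eq_zero hq0 (by rw [card_insert_of_notMem hjR, hR]),
      add_single_le hpK hpR, add_single_le hqK hqR, ?_, ?_, fun k => ?_⟩
    · simp only [Pi.add_apply, sum_add_distrib, Finset.sum_pi_single', mem_univ, if_true]
      push_cast at *
      linarith
    · simp only [Pi.add_apply, sum_add_distrib, Finset.sum_pi_single', mem_univ, if_true]
      push_cast at *
      linarith
    · have hk := heq k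
      rw [sum_add_single_mul_indicator, sum_add_single_mul_indicator]
      simp only [Pi.add_apply, Pi.sub_apply, Pi.single_apply] at hk
      by_cases h1 : k = i
      · subst h1
        simp [hij, hiR] at hk ⊢
        linarith
      · by_cases h2 : k = j
        · subst h2
          simp [h1, hjR] at hk ⊢
          linarith
        · simp [h1, h2] at hk ⊢
          linarith

/-- Every `w ∈ ℤ^m` whose coordinates sum to zero is an integer combination
`w = Σ_S a_S 1_S` of indicators of `t`-element subsets `S ⊆ [m]`, with all coefficients
bounded: `|a_S| ≤ ‖w‖₁ / C(m-2, t-1) + 1`. -/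
theorem lattice_decomposition_sum_zero (m t : ℕ) (ht : 1 ≤ t) (htm : t + 1 ≤ m)
    (w : Fin m → ℤ) (hw : ∑ i, w i = 0) :
    ∃ a : Finset (Fin m) → ℤ,
      (∀ S : Finset (Fin m), S.card ≠ t → a S = 0) ∧
      (∀ j : Fin m, ∑ S : Finset (Fin m), a S * (if j ∈ S then 1 else 0) = w j) ∧
      (∀ S : Finset (Fin m),
        (|a S| : ℝ) ≤ ((∑ i, |w i| : ℤ) : ℝ) / ((m - 2).choose (t - 1)) + 1) := by
  obtain ⟨u, rfl⟩ : ∃ u, t = u + 1 := ⟨t - 1, by omega⟩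
  rw [Nat.add_sub_cancel]
  set N := (m - 2).choose u
  have hN : 0 < N := Nat.choose_pos (by omega)
  obtain ⟨s, hs⟩ := Int.eq_ofNat_of_zero_le (sum_nonneg fun i _ => abs_nonneg (w i) :
    0 ≤ ∑ i, |w i|)
  obtain ⟨p, q, hp0, hq0, hpK, hqK, -, -, heq⟩ :=
    exists_bounded_decomposition (t := u) (K := s / N + 1) s w hw hs.le (by
      rw [hs]
      exact_mod_cast Nat.lt_mul_of_div_lt (Nat.lt_succ_self _) hN)
  refine ⟨fun S => p S - q S, fun S hS => by simp [hp0 S hS, hq0 S hS], fun k => ?_, fun S => ?_⟩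
  · simp only [sub_mul, sum_sub_distrib]
    exact heq k
  · have hb : |(p S : ℤ) - q S| ≤ ((s / N + 1 : ℕ) : ℤ) := by
      have := hpK S
      have := hqK S
      rw [abs_le]
      constructor <;> omega
    rw [hs]
    calc |(((p S : ℤ) - q S : ℤ) : ℝ)| ≤ ((s / N + 1 : ℕ) : ℝ) := by
          rw [← Int.cast_abs, ← Int.cast_natCast (s / N + 1)]
          exact Int.cast_le.2 hb
      _ ≤ ((s : ℤ) : ℝ) / N + 1 := by
        push_cast
        gcongr
        exact Nat.cast_div_le
end
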